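/- Let f ∈ 𝒜* have a recurrent critical point c, and let T = T⁰ ⊃ T¹ ⊃ … ⊃ T^m be a maximal central cascade of small symmetric nice intervals. If T¹ is τ-well inside T⁰, then for each 1 ≤ i < m, T^i is a τ'-non-central-nice interval, where τ' > 0 depends only on τ. Here a nice interval is τ'-non-central-nice if all its return domains, except possibly the one containing c, are τ'-well inside it. -/

import Mathlib

open Set Function MeasureTheory Filter Topology
open scoped Classical

noncomputable section

/-- Length (Lebesgue measure) of a set of reals. -/
def len (S : Set ℝ) : ℝ := (volume S).toReal

/-- A bounded open interval. -/
def IsOpenInterval (S : Set ℝ) : Prop := ∃ a b : ℝ, a < b ∧ S = Set.Ioo a b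

/-- The ω-limit set of a point under iteration of `f`. -/
def omegaLimitSet (f : ℝ → ℝ) (x : ℝ) : Set ℝ :=
  ⋂ N : ℕ, closure ((fun n => f^[n] x) '' {n : ℕ | N ≤ n})

/-- Unimodal maps of class 𝒜 with turning point `c`, which is non-flat of order `ℓ`:
continuous on `[0,1]`, strictly increasing on `[0,c]`, strictly decreasing on `[c,1]`,
`C³` outside `c` with non-vanishing derivative, and `|ψ⁻¹ ∘ f ∘ φ (x)| = |x|^ℓ`
near `0` for `C³` local diffeomorphisms `φ, ψ` with `φ 0 = c`, `ψ 0 = f c`. -/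
structure UnimodalA (f : ℝ → ℝ) (c ℓ : ℝ) : Prop where
  cont : ContinuousOn f (Set.Icc 0 1)
  maps : Set.MapsTo f (Set.Icc 0 1) (Set.Icc 0 1)
  c_mem : c ∈ Set.Ioo (0:ℝ) 1
  mono : StrictMonoOn f (Set.Icc 0 c)
  anti : StrictAntiOn f (Set.Icc c 1)
  smooth : ContDiffOn ℝ 3 f (Set.Icc 0 1 \ {c})
  deriv_ne : ∀ x ∈ Set.Icc 0 1 \ {c}, deriv f x ≠ 0
  ell_gt_one : 1 < ℓ
  nonflat : ∃ φ ψ : ℝ → ℝ, φ 0 = c ∧ ψ 0 = f c ∧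
    (∃ U ∈ 𝓝 (0:ℝ), ContDiffOn ℝ 3 φ U ∧ ContDiffOn ℝ 3 ψ U) ∧
    deriv φ 0 ≠ 0 ∧ deriv ψ 0 ≠ 0 ∧
    ∃ s : ℝ, |s| = 1 ∧ ∀ᶠ x in 𝓝 (0:ℝ), f (φ x) = ψ (s * |x| ^ ℓ)

/-- All periodic points of `f` in `[0,1]` are hyperbolic repelling. -/
def AllPeriodicHyperbolicRepelling (f : ℝ → ℝ) : Prop :=
  ∀ x ∈ Set.Icc (0:ℝ) 1, ∀ p : ℕ, 0 < p → f^[p] x = x → 1 < |deriv (f^[p]) x|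

/-- The class 𝒜₊ : maps in 𝒜 with all periodic points hyperbolic repelling. -/
def UnimodalAStar (f : ℝ → ℝ) (c ℓ : ℝ) : Prop :=
  UnimodalA f c ℓ ∧ AllPeriodicHyperbolicRepelling f

/-- A (minimal) metric attractor: a compact invariant set whose realm of attraction has
positive Lebesgue measure, while no proper compact invariant subset has this property. -/
def IsMetricAttractor (f : ℝ → ℝ) (X : Set ℝ) : Prop :=
  IsCompact X ∧ X ⊆ Set.Icc 0 1 ∧ f '' X ⊆ X ∧
  0 < volume {x ∈ Set.Icc (0:ℝ) 1 | omegaLimitSet f x ⊆ X} ∧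
  ∀ X' : Set ℝ, X' ⊂ X → IsCompact X' → f '' X' ⊆ X' →
    volume {x ∈ Set.Icc (0:ℝ) 1 | omegaLimitSet f x ⊆ X'} = 0

/-- A Cantor set: nonempty, compact, perfect, totally disconnected. -/
def IsCantorSet (X : Set ℝ) : Prop :=
  X.Nonempty ∧ IsCompact X ∧ Perfect X ∧ IsTotallyDisconnected X

/-- A nice interval: an open interval `T ⊆ [0,1]` such that the forward orbit of `∂T`
never enters `T`, and `T` contains no fixed point of `f`. -/
def IsNiceInterval (f : ℝ → ℝ) (T : Set ℝ) : Prop :=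
  IsOpenInterval T ∧ T ⊆ Set.Icc 0 1 ∧
  (∀ n : ℕ, ∀ x ∈ frontier T, f^[n] x ∉ T) ∧
  (∀ x ∈ T, f x ≠ x)

/-- A symmetric nice interval containing `c`: `f(∂T)` is a single point. -/
def IsSymmNice (f : ℝ → ℝ) (c : ℝ) (T : Set ℝ) : Prop :=
  IsNiceInterval f T ∧ c ∈ T ∧ ∃ y : ℝ, ∀ x ∈ frontier T, f x = y

/-- `D(T)`: the set of points entering `T` under some positive iterate. -/
def entryDomain (f : ℝ → ℝ) (T : Set ℝ) : Set ℝ :=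
  {x | ∃ k : ℕ, 1 ≤ k ∧ f^[k] x ∈ T}

/-- The return domain of `T` containing `x` (component of `D(T) ∩ T`). -/
def returnDomain (f : ℝ → ℝ) (T : Set ℝ) (x : ℝ) : Set ℝ :=
  connectedComponentIn (entryDomain f T ∩ T) x

/-- `U` is a return domain of `T`. -/
def IsReturnDomain (f : ℝ → ℝ) (T U : Set ℝ) : Prop :=
  ∃ x ∈ entryDomain f T ∩ T, U = returnDomain f T x

/-- `k` is the first return time of `x` to `T`. -/
def IsFirstReturnTime (f : ℝ → ℝ) (T : Set ℝ) (x : ℝ) (k : ℕ) : Prop :=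
  1 ≤ k ∧ f^[k] x ∈ T ∧ ∀ j : ℕ, 1 ≤ j → j < k → f^[j] x ∉ T

/-- `J` is a pull back of `V` by `f^k`, i.e. a connected component of `f^{-k}(V)`. -/
def IsPullbackBy (f : ℝ → ℝ) (V J : Set ℝ) (k : ℕ) : Prop :=
  ∃ x ∈ f^[k] ⁻¹' V, J = connectedComponentIn (f^[k] ⁻¹' V) x

/-- `J` is a child of `T` with transition time `k`: a unimodal pull back of `T`
containing `c`, i.e. `f^{k-1}` maps a neighborhood of `f(J)` diffeomorphically
(injectively) onto `T`. -/
def IsChildWithTime (f : ℝ → ℝ) (c : ℝ) (T J : Set ℝ) (k : ℕ) : Prop :=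
  1 ≤ k ∧ c ∈ J ∧ IsPullbackBy f T J k ∧
  ∃ W : Set ℝ, IsOpen W ∧ f '' J ⊆ W ∧ Set.InjOn (f^[k - 1]) W ∧ f^[k - 1] '' W = T

/-- `J` is a child of `T`. -/
def IsChild (f : ℝ → ℝ) (c : ℝ) (T J : Set ℝ) : Prop :=
  ∃ k : ℕ, IsChildWithTime f c T J k

/-- The number `ν(T)` of children of `T`. -/
def numChildren (f : ℝ → ℝ) (c : ℝ) (T : Set ℝ) : ℕ :=
  {J : Set ℝ | IsChild f c T J}.ncard

/-- The interval `J` is `τ`-well inside the interval `I`: both components of `I ∖ J`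
have length at least `τ·|J|`. -/
def WellInside (τ : ℝ) (J I : Set ℝ) : Prop :=
  ∃ a b a' b' : ℝ, a' ≤ a ∧ a < b ∧ b ≤ b' ∧ J = Set.Ioo a b ∧ I = Set.Ioo a' b' ∧
    τ * (b - a) ≤ a - a' ∧ τ * (b - a) ≤ b' - b

/-- A `τ`-nice interval: every return domain is `τ`-well inside it. -/
def IsTauNice (f : ℝ → ℝ) (τ : ℝ) (T : Set ℝ) : Prop :=
  ∀ x ∈ entryDomain f T ∩ T, WellInside τ (returnDomain f T x) T

/-- A `τ`-non-central-nice interval: every return domain, except possibly the one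
containing `c`, is `τ`-well inside it. -/
def IsNonCentralTauNice (f : ℝ → ℝ) (c : ℝ) (τ : ℝ) (T : Set ℝ) : Prop :=
  ∀ x ∈ entryDomain f T ∩ T, c ∉ returnDomain f T x →
    WellInside τ (returnDomain f T x) T

/-- `I` is a restrictive interval of period `s` for `f`. -/
def IsRenormInterval (f : ℝ → ℝ) (c : ℝ) (I : Set ℝ) (s : ℕ) : Prop :=
  (∃ a b : ℝ, a < b ∧ I = Set.Icc a b) ∧ c ∈ interior I ∧ 2 ≤ s ∧
  (∀ i j : ℕ, i < j → j < s → interior (f^[i] '' I) ∩ interior (f^[j] '' I) = ∅) ∧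
  f^[s] '' I ⊆ I ∧ f^[s] '' frontier I ⊆ frontier I

/-- `f` is renormalizable. -/
def Renormalizable (f : ℝ → ℝ) (c : ℝ) : Prop :=
  ∃ I s, IsRenormInterval f c I s

/-- `f` is infinitely renormalizable: restrictive intervals of arbitrarily large period. -/
def InfinitelyRenormalizable (f : ℝ → ℝ) (c : ℝ) : Prop :=
  ∀ N : ℕ, ∃ I s, N ≤ s ∧ IsRenormInterval f c I s

/-- `X` is a minimal set for `f`. -/
def IsMinimalOn (f : ℝ → ℝ) (X : Set ℝ) : Prop :=
  X.Nonempty ∧ IsClosed X ∧ f '' X ⊆ X ∧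
  ∀ x ∈ X, X ⊆ closure {y | ∃ n : ℕ, f^[n] x = y}

/-- The collection of connected components of `S` which intersect `ω(c)`. -/
def componentsMeeting (f : ℝ → ℝ) (c : ℝ) (S : Set ℝ) : Set (Set ℝ) :=
  {U | (∃ x ∈ S, U = connectedComponentIn S x) ∧ (U ∩ omegaLimitSet f c).Nonempty}

/-- The nice cover 𝒴 of `ω(c)` associated with a symmetric nice interval `Y`:
components of `Y ∪ D(Y)` meeting `ω(c)`. -/
def niceCover (f : ℝ → ℝ) (c : ℝ) (Y : Set ℝ) : Set (Set ℝ) :=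
  componentsMeeting f c (Y ∪ entryDomain f Y)

/-- `q(𝒴, n)`: the number of components of `f^{-n}(Y ∪ D(Y))` intersecting `ω(c)`. -/
def qCount (f : ℝ → ℝ) (c : ℝ) (Y : Set ℝ) (n : ℕ) : ℕ :=
  (componentsMeeting f c (f^[n] ⁻¹' (Y ∪ entryDomain f Y))).ncard

/-- `Y₋ₙ`: the component of `f^{-n}(Y ∪ D(Y))` containing `c`. -/
def criticalPullbackOfEntry (f : ℝ → ℝ) (c : ℝ) (Y : Set ℝ) (n : ℕ) : Set ℝ :=
  connectedComponentIn (f^[n] ⁻¹' (Y ∪ entryDomain f Y)) c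

/-- `𝒰` is an open cover of `X`. -/
def IsOpenCover (X : Set ℝ) (𝒰 : Set (Set ℝ)) : Prop :=
  (∀ U ∈ 𝒰, IsOpen U) ∧ X ⊆ ⋃₀ 𝒰

/-- The cover `⋁_{i=0}^{n-1} f^{-i} 𝒰`. -/
def coverJoin (f : ℝ → ℝ) (𝒰 : Set (Set ℝ)) (n : ℕ) : Set (Set ℝ) :=
  {V | ∃ U : Fin n → Set ℝ, (∀ i, U i ∈ 𝒰) ∧ V = ⋂ i : Fin n, f^[(i : ℕ)] ⁻¹' U i}

/-- The topological complexity function `p(𝒰, n) = N(⋁_{i=0}^{n-1} f^{-i} 𝒰)`: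
the minimal cardinality of a finite subcover of `X` from the joined cover. -/
def complexity (f : ℝ → ℝ) (X : Set ℝ) (𝒰 : Set (Set ℝ)) (n : ℕ) : ℕ :=
  sInf {m : ℕ | ∃ 𝒱 : Set (Set ℝ), 𝒱 ⊆ coverJoin f 𝒰 n ∧ 𝒱.Finite ∧
        X ⊆ ⋃₀ 𝒱 ∧ 𝒱.ncard = m}

/-- A maximal central cascade `T⁰ ⊃ T¹ ⊃ ⋯ ⊃ Tᵐ` with common first return time `s`. -/
def IsMaximalCentralCascade (f : ℝ → ℝ) (c : ℝ) (T : ℕ → Set ℝ) (m s : ℕ) : Prop :=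
  1 ≤ m ∧ 1 ≤ s ∧ (∀ i ≤ m, IsSymmNice f c (T i)) ∧
  (∀ i < m, T (i + 1) = returnDomain f (T i) c) ∧
  (∀ i < m, IsFirstReturnTime f (T i) c s) ∧ f^[s] c ∉ T m

/-- `Λ`: the union of the components of `I ∪ D(I)` which intersect `ω(c)`. -/
def LambdaSet (f : ℝ → ℝ) (c : ℝ) (I : Set ℝ) : Set ℝ :=
  {x | x ∈ I ∪ entryDomain f I ∧
       (connectedComponentIn (I ∪ entryDomain f I) x ∩ omegaLimitSet f c).Nonempty}

/-- `Λ(T)`: points which enter `T` while staying in `Λ` before doing so. -/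
def LambdaT (f : ℝ → ℝ) (c : ℝ) (I T : Set ℝ) : Set ℝ :=
  {x | ∃ k : ℕ, 1 ≤ k ∧ (∀ j < k, f^[j] x ∈ LambdaSet f c I) ∧ f^[k] x ∈ T}

/-- The fixed base interval `I`: a symmetric nice interval containing `c` such that
the associated `Λ` is compactly contained in `[f²(c), f(c)]`. -/
def GoodBase (f : ℝ → ℝ) (c : ℝ) (I : Set ℝ) : Prop :=
  IsSymmNice f c I ∧ closure (LambdaSet f c I) ⊆ Set.Ioo (f (f c)) (f c)

/-- `λ(Y'|Y)`: the supremum over diffeomorphisms `f^s : J → Y` of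
`|(f^s|J)^{-1}(Y')| / |J|`. -/
def lamRatio (f : ℝ → ℝ) (Y' Y : Set ℝ) : ℝ :=
  sSup {r : ℝ | ∃ (s : ℕ) (J : Set ℝ), IsOpenInterval J ∧
        Set.InjOn (f^[s]) J ∧ f^[s] '' J = Y ∧
        r = len (J ∩ f^[s] ⁻¹' Y') / len J}

/-- `ξ(Y'|Y) = 1 − λ(Y'|Y)`. -/
def xiRel (f : ℝ → ℝ) (Y' Y : Set ℝ) : ℝ := 1 - lamRatio f Y' Y

/-- The empty space `ξ(T) = ξ(Λ(T) ∩ T | T)`. -/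
def xiT (f : ℝ → ℝ) (c : ℝ) (I T : Set ℝ) : ℝ :=
  xiRel f (LambdaT f c I T ∩ T) T

/-- `Y_{-j}` in the chain of pull backs of `Y` along the orbit `c, f(c), …, fⁿ(c)`:
the component of `f^{-j}(Y)` containing `f^{n-j}(c)`. -/
def chainAt (f : ℝ → ℝ) (c : ℝ) (Y : Set ℝ) (n j : ℕ) : Set ℝ :=
  connectedComponentIn (f^[j] ⁻¹' Y) (f^[n - j] c)

/-- The set of transition times `s_j` occurring in the chain from `Y_{-n}` to `Y`:
gaps between consecutive critical positions in the chain. -/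
def essentialTimes (f : ℝ → ℝ) (c : ℝ) (Y : Set ℝ) (n : ℕ) : Set ℕ :=
  {s : ℕ | ∃ j j' : ℕ, j < j' ∧ j' ≤ n ∧ c ∈ chainAt f c Y n j ∧ c ∈ chainAt f c Y n j' ∧
    (∀ i : ℕ, j < i → i < j' → c ∉ chainAt f c Y n i) ∧ s = j' - j}

/-- The essential order `M_n(Y)`: the number of distinct transition times in the chain. -/
def essentialOrder (f : ℝ → ℝ) (c : ℝ) (Y : Set ℝ) (n : ℕ) : ℕ :=
  (essentialTimes f c Y n).ncard

/-- The first (largest) child of `T`. -/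
def IsFirstChild (f : ℝ → ℝ) (c : ℝ) (T J : Set ℝ) : Prop :=
  IsChild f c T J ∧ ∀ J', IsChild f c T J' → J' ⊆ J

/-- The second child of `T`: the second largest child. -/
def IsSecondChild (f : ℝ → ℝ) (c : ℝ) (T J : Set ℝ) : Prop :=
  IsChild f c T J ∧ ∃ J₁, IsFirstChild f c T J₁ ∧ J ⊂ J₁ ∧
    ∀ J', IsChild f c T J' → J' ≠ J₁ → J' ⊆ J

/-- The principal nest `Y = Y₀ ⊃ Y₁ ⊃ ⋯` starting from `Y`. -/
def principalNest (f : ℝ → ℝ) (c : ℝ) (Y : Set ℝ) : ℕ → Set ℝ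
  | 0 => Y
  | n + 1 => returnDomain f (principalNest f c Y n) c

/-- `f` has special combinatorics, witnessed by the symmetric nice interval `Y`:
`ω(c) ∋ c` is minimal and each annulus `Yₙ ∖ Yₙ₊₁` of the principal nest has
exactly one component intersecting `ω(c)`. -/
def SpecialCombinatorics (f : ℝ → ℝ) (c : ℝ) (Y : Set ℝ) : Prop :=
  c ∈ omegaLimitSet f c ∧ IsMinimalOn f (omegaLimitSet f c) ∧ IsSymmNice f c Y ∧
  ∀ n : ℕ, ∃! U : Set ℝ,
    U ∈ componentsMeeting f c (principalNest f c Y n \ principalNest f c Y (n + 1))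

/-- The adding machine map `f_α` on `Δ_α = Π i, {0, …, pᵢ − 1}`. -/
def addingMachine (p : ℕ → ℕ) (hp : ∀ i, 2 ≤ p i) (x : ∀ i, Fin (p i)) :
    ∀ i, Fin (p i) :=
  if h : ∃ l, (x l : ℕ) + 1 < p l then fun i =>
    if i < Nat.find h then ⟨0, by have := hp i; omega⟩
    else if hi : i = Nat.find h then
      ⟨(x i : ℕ) + 1, by rw [hi]; exact Nat.find_spec h⟩
    else x i
  else fun i => ⟨0, by have := hp i; omega⟩

/-- `f` restricted to `X` is topologically conjugate to an adding machine. -/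
def ConjugateToAddingMachine (f : ℝ → ℝ) (X : Set ℝ) : Prop :=
  ∃ (p : ℕ → ℕ) (hp : ∀ i, 2 ≤ p i) (φ : ℝ → ∀ i, Fin (p i)),
    ContinuousOn φ X ∧ Set.InjOn φ X ∧ φ '' X = Set.univ ∧
    ∀ x ∈ X, φ (f x) = addingMachine p hp (φ x)

/-- `f` restricted to `X` is equicontinuous (w.r.t. all iterates). -/
def EquicontinuousOnSet (f : ℝ → ℝ) (X : Set ℝ) : Prop :=
  ∀ ε > 0, ∃ δ > 0, ∀ x ∈ X, ∀ y ∈ X, |x - y| < δ →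
    ∀ n : ℕ, |f^[n] x - f^[n] y| < ε

/-- Logarithm of the cross ratio `|b' - a| |d - b| / (|b - a| |d - b'|)`: the hyperbolic length
of `[b, b']` in `(a, d)`. -/
def crossLog (a b b' d : ℝ) : ℝ :=
  Real.log (b' - a) + Real.log (d - b) - Real.log (b - a) - Real.log (d - b')

lemma log_sub_comm (x y : ℝ) : Real.log (x - y) = Real.log (y - x) := by
  rw [← Real.log_neg_eq_log, neg_sub]

lemma crossLog_add (a b e b' d : ℝ) :
    crossLog a b e d + crossLog a e b' d = crossLog a b b' d := by
  unfold crossLog; ring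

lemma crossLog_rev (a b b' d : ℝ) : crossLog d b' b a = crossLog a b b' d := by
  unfold crossLog
  rw [log_sub_comm b d, log_sub_comm a b', log_sub_comm b' d, log_sub_comm a b]; ring

lemma crossLog_swap (a b b' d : ℝ) : crossLog a b' b d = -crossLog a b b' d := by
  unfold crossLog; ring

lemma crossLog_neg (a b b' d : ℝ) : crossLog (-a) (-b) (-b') (-d) = crossLog a b b' d := by
  unfold crossLog
  simp only [neg_sub_neg]
  rw [log_sub_comm a b', log_sub_comm b' d, log_sub_comm b d, log_sub_comm a b]

/-- The second difference of a function with Lipschitz derivative. -/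
lemma second_difference_bound {p q K : ℝ} {g g' : ℝ → ℝ}
    (hg : ∀ x ∈ Icc p q, HasDerivWithinAt g (g' x) (Icc p q) x)
    (hK : ∀ x ∈ Icc p q, ∀ y ∈ Icc p q, |g' x - g' y| ≤ K * |x - y|)
    {u α β : ℝ} (h0 : u ∈ Icc p q) (h1 : u + α ∈ Icc p q) (h2 : u + β ∈ Icc p q)
    (h3 : u + α + β ∈ Icc p q) :
    |(g (u + α + β) - g (u + α)) - (g (u + β) - g u)| ≤ K * |α| * |β| := by
  have hs : ∀ v ∈ uIcc u (u + α), v ∈ Icc p q ∧ v + β ∈ Icc p q := by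
    intro v hv
    rw [mem_uIcc] at hv
    simp only [mem_Icc] at *
    rcases hv with hv | hv <;> refine ⟨⟨?_, ?_⟩, ?_, ?_⟩ <;> linarith
  have key := (convex_uIcc u (u + α)).norm_image_sub_le_of_norm_hasDerivWithin_le
    (f := fun v => g (v + β) - g v) (f' := fun v => g' (v + β) - g' v) (C := K * |β|)
    (x := u) (y := u + α) ?_ ?_ left_mem_uIcc right_mem_uIcc
  · simp only [Real.norm_eq_abs, add_sub_cancel_left] at key
    calc _ ≤ _ := key
      _ = _ := by ring
  · intro v hv
    obtain ⟨hv1, hv2⟩ := hs v hv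
    refine HasDerivWithinAt.sub ?_ ((hg v hv1).mono fun w hw => (hs w hw).1)
    have := HasDerivWithinAt.comp (h := fun v => v + β) (h₂ := g) (s := uIcc u (u + α)) v
      (hg (v + β) hv2) ((hasDerivWithinAt_id v _).add_const β) (fun w hw => (hs w hw).2)
    rw [mul_one] at this
    exact this
  · intro v hv
    obtain ⟨hv1, hv2⟩ := hs v hv
    simpa using hK _ hv2 _ hv1

lemma crossLog_le_of_second_derivative {p q K M κ : ℝ} {g g₁ g₂ : ℝ → ℝ}
    (hg : ∀ x ∈ Icc p q, HasDerivWithinAt g (g₁ x) (Icc p q) x)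
    (hg₁ : ∀ x ∈ Icc p q, HasDerivWithinAt g₁ (g₂ x) (Icc p q) x)
    (hK : ∀ x ∈ Icc p q, ∀ y ∈ Icc p q, |g₂ x - g₂ y| ≤ K * |x - y|)
    (hM : ∀ x ∈ Icc p q, ∀ y ∈ Icc p q, |g₁ x - g₁ y| ≤ M * |x - y|)
    (hM' : ∀ x ∈ Icc p q, g₁ x ≤ M) (hκ : 0 < κ) (hκ' : ∀ x ∈ Icc p q, κ ≤ g₁ x)
    {a b b' d : ℝ} (ha : a ∈ Icc p q) (hb : b ∈ Icc p q) (hb' : b' ∈ Icc p q)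
    (hd : d ∈ Icc p q) (hab : a ≠ b) (hab' : a ≠ b') (hdb : d ≠ b) (hdb' : d ≠ b') :
    crossLog a b b' d ≤ crossLog (g a) (g b) (g b') (g d) +
      (|K| * M + M * M) / κ ^ 2 * |d - a| * |b' - b| := by
  have hseg : ∀ x ∈ Icc p q, ∀ y ∈ Icc p q, ∀ t ∈ Icc (0:ℝ) 1, y + t * (x - y) ∈ Icc p q := by
    intro x hx y hy t ht
    have := (convex_Icc p q).add_smul_sub_mem hy hx ht
    simpa using this
  have hcont : ContinuousOn g₁ (Icc p q) := fun x hx => (hg₁ x hx).continuousWithinAt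
  have hci : ∀ x ∈ Icc p q, ∀ y ∈ Icc p q,
      ContinuousOn (fun t : ℝ => g₁ (y + t * (x - y))) (uIcc 0 1) := by
    intro x hx y hy
    rw [uIcc_of_le zero_le_one]
    exact hcont.comp (by fun_prop) (fun t ht => hseg x hx y hy t ht)
  have hii := fun x hx y hy => (hci x hx y hy).intervalIntegrable (μ := volume)
  let Q : ℝ → ℝ → ℝ := fun x y => ∫ t in (0:ℝ)..1, g₁ (y + t * (x - y))
  have hQ : ∀ x ∈ Icc p q, ∀ y ∈ Icc p q, g x - g y = (x - y) * Q x y := by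
    intro x hx y hy
    have := intervalIntegral.integral_eq_sub_of_hasDerivAt_of_le (a := (0:ℝ)) (b := 1)
      (f := fun t => g (y + t * (x - y))) (f' := fun t => (x - y) * g₁ (y + t * (x - y)))
      zero_le_one ?_ ?_ ((hii x hx y hy).const_mul _)
    · simp only [Q]
      rw [← intervalIntegral.integral_const_mul, this]; simp
    · refine ContinuousOn.comp (t := Icc p q) (fun x hx => (hg x hx).continuousWithinAt)
        (by fun_prop) (fun t ht => hseg x hx y hy t ht)
    · intro t ht
      have h1 := HasDerivWithinAt.comp (h := fun t => y + t * (x - y)) (h₂ := g) (s := Icc 0 1) t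
        (hg _ (hseg x hx y hy t (Ioo_subset_Icc_self ht)))
        (((hasDerivWithinAt_id t _).mul_const (x - y)).const_add y)
        (fun w hw => hseg x hx y hy w hw)
      have h2 := h1.hasDerivAt (Icc_mem_nhds ht.1 ht.2)
      rw [one_mul, mul_comm] at h2
      exact h2
  have hQκ : ∀ x ∈ Icc p q, ∀ y ∈ Icc p q, κ ≤ Q x y := by
    intro x hx y hy
    have := intervalIntegral.integral_mono_on (a := (0:ℝ)) (b := 1) (f := fun _ => κ)
      zero_le_one (by simp) (hii x hx y hy) (fun t ht => hκ' _ (hseg x hx y hy t ht))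
    simpa using this
  have hQM : ∀ x ∈ Icc p q, ∀ y ∈ Icc p q, Q x y ≤ M := by
    intro x hx y hy
    have := intervalIntegral.integral_mono_on (a := (0:ℝ)) (b := 1) (g := fun _ => M)
      zero_le_one (hii x hx y hy) (by simp) (fun t ht => hM' _ (hseg x hx y hy t ht))
    simpa using this
  have hM0 : 0 < M := hκ.trans_le ((hκ' a ha).trans (hM' a ha))
  have hQ1 : ∀ x ∈ Icc p q, ∀ x' ∈ Icc p q, ∀ y ∈ Icc p q, |Q x y - Q x' y| ≤ M * |x - x'| := by
    intro x hx x' hx' y hy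
    simp only [Q]
    rw [← intervalIntegral.integral_sub (hii x hx y hy) (hii x' hx' y hy)]
    have := intervalIntegral.norm_integral_le_of_norm_le_const (a := (0:ℝ)) (b := 1)
      (f := fun t => g₁ (y + t * (x - y)) - g₁ (y + t * (x' - y))) (C := M * |x - x'|) ?_
    · simpa using this
    · intro t ht
      rw [uIoc_of_le zero_le_one] at ht
      have ht' := Ioc_subset_Icc_self ht
      refine (hM _ (hseg x hx y hy t ht') _ (hseg x' hx' y hy t ht')).trans ?_
      rw [show y + t * (x - y) - (y + t * (x' - y)) = t * (x - x') by ring, abs_mul,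
        abs_of_nonneg ht'.1]
      have := mul_le_mul_of_nonneg_right ht'.2 (abs_nonneg (x - x'))
      nlinarith
  have hQsymm : ∀ x ∈ Icc p q, ∀ y ∈ Icc p q, x ≠ y → Q x y = Q y x := by
    intro x hx y hy hxy
    have h1 := hQ x hx y hy
    have h2 := hQ y hy x hx
    apply mul_left_cancel₀ (sub_ne_zero.2 hxy)
    linarith
  have hQ2 : |(Q b' a - Q b a) - (Q b' d - Q b d)| ≤ |K| * |d - a| * |b' - b| := by
    simp only [Q]
    rw [← intervalIntegral.integral_sub (hii b' hb' a ha) (hii b hb a ha),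
      ← intervalIntegral.integral_sub (hii b' hb' d hd) (hii b hb d hd),
      ← intervalIntegral.integral_sub ((hii b' hb' a ha).sub (hii b hb a ha))
        ((hii b' hb' d hd).sub (hii b hb d hd))]
    have := intervalIntegral.norm_integral_le_of_norm_le_const (a := (0:ℝ)) (b := 1)
      (f := fun t => (g₁ (a + t * (b' - a)) - g₁ (a + t * (b - a))) -
        (g₁ (d + t * (b' - d)) - g₁ (d + t * (b - d)))) (C := |K| * |d - a| * |b' - b|) ?_
    · simpa using this
    · intro t ht
      rw [uIoc_of_le zero_le_one] at ht
      have ht' := Ioc_subset_Icc_self ht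
      have h := second_difference_bound hg₁ (fun x hx y hy => (hK x hx y hy).trans
          (mul_le_mul_of_nonneg_right (le_abs_self K) (abs_nonneg _)))
        (u := d + t * (b - d)) (α := (1 - t) * (a - d)) (β := t * (b' - b))
        (hseg b hb d hd t ht')
        (by convert hseg b hb a ha t ht' using 1; ring)
        (by convert hseg b' hb' d hd t ht' using 1; ring)
        (by convert hseg b' hb' a ha t ht' using 1; ring)
      have e1 : d + t * (b - d) + (1 - t) * (a - d) + t * (b' - b) = a + t * (b' - a) := by ring
      have e2 : d + t * (b - d) + (1 - t) * (a - d) = a + t * (b - a) := by ring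
      have e3 : d + t * (b - d) + t * (b' - b) = d + t * (b' - d) := by ring
      rw [e1, e2, e3] at h
      rw [Real.norm_eq_abs]
      refine h.trans ?_
      rw [abs_mul, abs_mul, abs_of_nonneg ht'.1, abs_of_nonneg (sub_nonneg.2 ht'.2),
        abs_sub_comm a d]
      have h3 : (1 - t) * |d - a| ≤ |d - a| := by
        nlinarith [abs_nonneg (d - a), ht'.1]
      have h4 : t * |b' - b| ≤ |b' - b| := by
        nlinarith [abs_nonneg (b' - b), ht'.2]
      have h5 : 0 ≤ t * |b' - b| := mul_nonneg ht'.1 (abs_nonneg _)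
      have h6 : 0 ≤ |K| * |d - a| := by positivity
      calc |K| * ((1 - t) * |d - a|) * (t * |b' - b|) ≤ |K| * |d - a| * (t * |b' - b|) := by
            gcongr
        _ ≤ _ := by gcongr
  set P := Q b' a
  set R := Q b a
  set S := Q b' d
  set V := Q b d
  have hPκ := hQκ b' hb' a ha
  have hRκ := hQκ b hb a ha
  have hSκ := hQκ b' hb' d hd
  have hVκ := hQκ b hb d hd
  have hlog : crossLog (g a) (g b) (g b') (g d) =
      crossLog a b b' d + (Real.log P + Real.log V - Real.log R - Real.log S) := by
    unfold crossLog
    rw [log_sub_comm (g d) (g b), log_sub_comm (g d) (g b'), hQ b' hb' a ha, hQ b hb a ha,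
      hQ b hb d hd, hQ b' hb' d hd,
      Real.log_mul (sub_ne_zero.2 hab'.symm) (hκ.trans_le hPκ).ne',
      Real.log_mul (sub_ne_zero.2 hab.symm) (hκ.trans_le hRκ).ne',
      Real.log_mul (sub_ne_zero.2 hdb.symm) (hκ.trans_le hVκ).ne',
      Real.log_mul (sub_ne_zero.2 hdb'.symm) (hκ.trans_le hSκ).ne',
      log_sub_comm d b, log_sub_comm d b']
    ring
  have hP0 := hκ.trans_le hPκ
  have hR0 := hκ.trans_le hRκ
  have hS0 := hκ.trans_le hSκ
  have hV0 := hκ.trans_le hVκ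
  have hl : Real.log (R * S / (P * V)) ≤ R * S / (P * V) - 1 :=
    Real.log_le_sub_one_of_pos (by positivity)
  rw [Real.log_div (by positivity) (by positivity), Real.log_mul hR0.ne' hS0.ne',
    Real.log_mul hP0.ne' hV0.ne'] at hl
  have hVR : |V - R| ≤ M * |d - a| := by
    have := hQ1 d hd a ha b hb
    rwa [hQsymm d hd b hb hdb, hQsymm a ha b hb hab] at this
  have hSV : |S - V| ≤ M * |b' - b| := hQ1 b' hb' b hb d hd
  have hdiff : R * S - P * V ≤ (|K| * M + M * M) * |d - a| * |b' - b| := by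
    have e : R * S - P * V = -((P - R - (S - V)) * V) - (S - V) * (V - R) := by ring
    rw [e]
    have h1 : -((P - R - (S - V)) * V) ≤ |K| * |d - a| * |b' - b| * M := by
      refine (neg_le_abs _).trans ?_
      rw [abs_mul, abs_of_pos hV0]
      exact mul_le_mul hQ2 (hQM b hb d hd) hV0.le (by positivity)
    have h2 : -((S - V) * (V - R)) ≤ (M * |b' - b|) * (M * |d - a|) := by
      refine (neg_le_abs _).trans ?_
      rw [abs_mul]
      exact mul_le_mul hSV hVR (abs_nonneg _) (by positivity)
    nlinarith
  have hfin : R * S / (P * V) - 1 ≤ (|K| * M + M * M) / κ ^ 2 * |d - a| * |b' - b| := by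
    have e : R * S / (P * V) - 1 = (R * S - P * V) / (P * V) := by
      rw [sub_div, div_self (mul_pos hP0 hV0).ne']
    rw [e]
    have : (|K| * M + M * M) / κ ^ 2 * |d - a| * |b' - b| =
      ((|K| * M + M * M) * |d - a| * |b' - b|) / κ ^ 2 := by ring
    rw [this]
    refine (div_le_div_of_nonneg_right hdiff (by positivity)).trans ?_
    apply div_le_div_of_nonneg_left (by positivity) (by positivity)
    nlinarith
  rw [hlog]
  linarith

lemma lipschitz_of_contDiffOn_one {g : ℝ → ℝ} {p q : ℝ} (hpq : p < q)
    (hg : ContDiffOn ℝ 1 g (Icc p q)) :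
    ∃ K, ∀ x ∈ Icc p q, ∀ y ∈ Icc p q, |g x - g y| ≤ K * |x - y| := by
  have hc : ContinuousOn (derivWithin g (Icc p q)) (Icc p q) :=
    (hg.derivWithin (m := 0) (uniqueDiffOn_Icc hpq) (by norm_num)).continuousOn
  obtain ⟨K, hK⟩ := isCompact_Icc.exists_bound_of_continuousOn hc
  refine ⟨K, fun x hx y hy => ?_⟩
  have := (convex_Icc p q).norm_image_sub_le_of_norm_hasDerivWithin_le
    (fun x hx => ((hg.differentiableOn (by norm_num)) x hx).hasDerivWithinAt) hK hy hx
  simpa [Real.norm_eq_abs] using this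

lemma exists_crossLog_le_of_contDiffOn_pos {g : ℝ → ℝ} {p q : ℝ} (hpq : p < q)
    (hg : ContDiffOn ℝ 3 g (Icc p q)) (hpos : ∀ x ∈ Icc p q, 0 < derivWithin g (Icc p q) x) :
    ∃ C ≥ 0, ∃ κ > 0, ∃ M > 0,
      (∀ x ∈ Icc p q, ∀ y ∈ Icc p q, κ * |x - y| ≤ |g x - g y|) ∧
      (∀ x ∈ Icc p q, ∀ y ∈ Icc p q, |g x - g y| ≤ M * |x - y|) ∧
      ∀ a ∈ Icc p q, ∀ b ∈ Icc p q, ∀ b' ∈ Icc p q, ∀ d ∈ Icc p q,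
        a ≠ b → a ≠ b' → d ≠ b → d ≠ b' →
        crossLog a b b' d ≤ crossLog (g a) (g b) (g b') (g d) + C * |d - a| * |b' - b| := by
  have hu := uniqueDiffOn_Icc hpq
  set g₁ := derivWithin g (Icc p q) with hg₁
  have h1 : ContDiffOn ℝ 2 g₁ (Icc p q) := hg.derivWithin hu (by norm_num)
  set g₂ := derivWithin g₁ (Icc p q) with hg₂
  have h2 : ContDiffOn ℝ 1 g₂ (Icc p q) := h1.derivWithin hu (by norm_num)
  obtain ⟨K, hK⟩ := lipschitz_of_contDiffOn_one hpq h2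
  obtain ⟨M₁, hM₁⟩ := lipschitz_of_contDiffOn_one hpq (h1.of_le (by norm_num))
  obtain ⟨M₂, hM₂⟩ := lipschitz_of_contDiffOn_one hpq (hg.of_le (by norm_num))
  obtain ⟨M₃, hM₃⟩ := isCompact_Icc.exists_bound_of_continuousOn h1.continuousOn
  obtain ⟨z, hz, hzmin⟩ := isCompact_Icc.exists_isMinOn (nonempty_Icc.2 hpq.le) h1.continuousOn
  have hκ := hpos z hz
  have hκ' : ∀ x ∈ Icc p q, g₁ z ≤ g₁ x := fun x hx => hzmin hx
  have hd : ∀ x ∈ Icc p q, HasDerivWithinAt g (g₁ x) (Icc p q) x := fun x hx =>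
    (hg.differentiableOn (by norm_num) x hx).hasDerivWithinAt
  have hd1 : ∀ x ∈ Icc p q, HasDerivWithinAt g₁ (g₂ x) (Icc p q) x := fun x hx =>
    (h1.differentiableOn (by norm_num) x hx).hasDerivWithinAt
  set M := max (max M₁ M₂) (max M₃ 1) with hM
  have hM1 : M₁ ≤ M := (le_max_left _ _).trans (le_max_left _ _)
  have hM2 : M₂ ≤ M := (le_max_right _ _).trans (le_max_left _ _)
  have hM3 : M₃ ≤ M := (le_max_left _ _).trans (le_max_right _ _)
  have hM4 : 1 ≤ M := (le_max_right _ _).trans (le_max_right _ _)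
  have hM0 : 0 < M := by linarith
  refine ⟨(|K| * M + M * M) / g₁ z ^ 2, by positivity, g₁ z, hκ, M, hM0, ?_, ?_, ?_⟩
  · have main : ∀ x ∈ Icc p q, ∀ y ∈ Icc p q, x ≤ y → g₁ z * (y - x) ≤ g y - g x := by
      intro x hx y hy hxy
      refine (convex_Icc p q).mul_sub_le_image_sub_of_le_deriv hg.continuousOn
        ((hg.differentiableOn (by norm_num)).mono interior_subset) ?_ x hx y hy hxy
      intro w hw
      have hw' := interior_subset hw
      rw [← (hd w hw').hasDerivAt (mem_interior_iff_mem_nhds.1 hw) |>.deriv.symm]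
      exact hκ' w hw'
    intro x hx y hy
    rcases le_total x y with h | h
    · rw [abs_sub_comm, abs_of_nonneg (sub_nonneg.2 h), abs_sub_comm]
      exact (main x hx y hy h).trans (le_abs_self _)
    · rw [abs_of_nonneg (sub_nonneg.2 h)]
      exact (main y hy x hx h).trans (le_abs_self _)
  · intro x hx y hy
    exact (hM₂ x hx y hy).trans (mul_le_mul_of_nonneg_right hM2 (abs_nonneg _))
  · intro a ha b hb b' hb' d hd'
    exact crossLog_le_of_second_derivative hd hd1 hK
      (fun x hx y hy => (hM₁ x hx y hy).trans (mul_le_mul_of_nonneg_right hM1 (abs_nonneg _)))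
      (fun x hx => ((le_abs_self _).trans (hM₃ x hx)).trans hM3) hκ hκ' ha hb hb' hd'

lemma exists_crossLog_le_of_contDiffOn {g : ℝ → ℝ} {p q : ℝ} (hpq : p < q)
    (hg : ContDiffOn ℝ 3 g (Icc p q)) (hne : ∀ x ∈ Icc p q, derivWithin g (Icc p q) x ≠ 0) :
    ∃ C ≥ 0, ∃ κ > 0, ∃ M > 0,
      (∀ x ∈ Icc p q, ∀ y ∈ Icc p q, κ * |x - y| ≤ |g x - g y|) ∧
      (∀ x ∈ Icc p q, ∀ y ∈ Icc p q, |g x - g y| ≤ M * |x - y|) ∧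
      ∀ a ∈ Icc p q, ∀ b ∈ Icc p q, ∀ b' ∈ Icc p q, ∀ d ∈ Icc p q,
        a ≠ b → a ≠ b' → d ≠ b → d ≠ b' →
        crossLog a b b' d ≤ crossLog (g a) (g b) (g b') (g d) + C * |d - a| * |b' - b| := by
  have hc : ContinuousOn (derivWithin g (Icc p q)) (Icc p q) :=
    (hg.derivWithin (m := 2) (uniqueDiffOn_Icc hpq) (by norm_num)).continuousOn
  by_cases hpos : ∀ x ∈ Icc p q, 0 < derivWithin g (Icc p q) x
  · exact exists_crossLog_le_of_contDiffOn_pos hpq hg hpos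
  · push Not at hpos
    obtain ⟨x₀, hx₀, hx₀'⟩ := hpos
    have hneg : ∀ x ∈ Icc p q, 0 < derivWithin (-g) (Icc p q) x := by
      intro x hx
      rw [derivWithin.neg]
      by_contra! h
      obtain ⟨y, hy, hy'⟩ := isPreconnected_Icc.intermediate_value hx₀ hx hc
        (show (0:ℝ) ∈ _ from ⟨hx₀', by linarith⟩)
      exact hne y hy hy'
    obtain ⟨C, hC, κ, hκ, M, hM, h1, h2, h3⟩ :=
      exists_crossLog_le_of_contDiffOn_pos hpq hg.neg hneg
    refine ⟨C, hC, κ, hκ, M, hM, ?_, ?_, ?_⟩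
    · intro x hx y hy
      have := h1 x hx y hy
      rwa [neg_sub_neg, abs_sub_comm (g y)] at this
    · intro x hx y hy
      have := h2 x hx y hy
      rwa [neg_sub_neg, abs_sub_comm (g y)] at this
    · intro a ha b hb b' hb' d hd e1 e2 e3 e4
      have := h3 a ha b hb b' hb' d hd e1 e2 e3 e4
      rwa [crossLog_neg] at this

lemma sinh_mul_div_sinh_mono {l : ℝ} (hl : 1 < l) :
    MonotoneOn (fun w => Real.sinh (l * w) / Real.sinh w) (Ioi 0) := by
  have hs : ∀ w : ℝ, HasDerivAt (fun w => Real.sinh (l * w)) (l * Real.cosh (l * w)) w := by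
    intro w
    have h : HasDerivAt (fun w : ℝ => l * w) l w := by
      simpa using (hasDerivAt_id w).const_mul l
    exact h.sinh.congr_deriv (mul_comm _ _)
  have hc : ∀ w : ℝ, HasDerivAt (fun w => Real.cosh (l * w)) (l * Real.sinh (l * w)) w := by
    intro w
    have h : HasDerivAt (fun w : ℝ => l * w) l w := by
      simpa using (hasDerivAt_id w).const_mul l
    exact h.cosh.congr_deriv (mul_comm _ _)
  have hN : ∀ w ∈ Ici (0:ℝ), 0 ≤ l * Real.cosh (l * w) * Real.sinh w -
      Real.sinh (l * w) * Real.cosh w := by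
    have hD : ∀ w : ℝ, HasDerivAt (fun w => l * Real.cosh (l * w) * Real.sinh w -
        Real.sinh (l * w) * Real.cosh w) ((l ^ 2 - 1) * Real.sinh (l * w) * Real.sinh w) w := by
      intro w
      have := (((hc w).const_mul l).mul (Real.hasDerivAt_sinh w)).sub
        ((hs w).mul (Real.hasDerivAt_cosh w))
      exact this.congr_deriv (by ring)
    have hm : MonotoneOn (fun w => l * Real.cosh (l * w) * Real.sinh w -
        Real.sinh (l * w) * Real.cosh w) (Ici 0) := by
      refine monotoneOn_of_deriv_nonneg (convex_Ici 0)
        (fun w _ => (hD w).continuousAt.continuousWithinAt)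
        (fun w _ => (hD w).differentiableAt.differentiableWithinAt) ?_
      intro w hw
      rw [interior_Ici] at hw
      rw [(hD w).deriv]
      have h1 : 0 ≤ Real.sinh w := Real.sinh_nonneg_iff.2 (le_of_lt hw)
      have h2 : 0 ≤ Real.sinh (l * w) :=
        Real.sinh_nonneg_iff.2 (mul_nonneg (by linarith) (le_of_lt hw))
      have h3 : 0 ≤ l ^ 2 - 1 := by nlinarith
      positivity
    intro w hw
    have := hm self_mem_Ici hw hw
    simpa using this
  have hD : ∀ w ∈ Ioi (0:ℝ), HasDerivAt (fun w => Real.sinh (l * w) / Real.sinh w)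
      ((l * Real.cosh (l * w) * Real.sinh w - Real.sinh (l * w) * Real.cosh w) /
        Real.sinh w ^ 2) w := fun w hw =>
    (hs w).div (Real.hasDerivAt_sinh w) (Real.sinh_pos_iff.2 hw).ne'
  refine monotoneOn_of_deriv_nonneg (convex_Ioi 0)
    (fun w hw => (hD w hw).continuousAt.continuousWithinAt) ?_ ?_
  · rw [interior_Ioi]
    exact fun w hw => (hD w hw).differentiableAt.differentiableWithinAt
  · rw [interior_Ioi]
    intro w hw
    rw [(hD w hw).deriv]
    exact div_nonneg (hN w (mem_Ici.2 (le_of_lt (mem_Ioi.1 hw)))) (by positivity)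

lemma crossLog_le_rpow_of_pos {l : ℝ} (hl : 1 < l) {a b b' d : ℝ} (ha : 0 < a) (hab : a < b)
    (hbb' : b ≤ b') (hbd : b' < d) :
    crossLog a b b' d ≤ crossLog (a ^ l) (b ^ l) (b' ^ l) (d ^ l) := by
  have hl0 : 0 < l := by linarith
  have hb : 0 < b := ha.trans hab
  have hb' : 0 < b' := hb.trans_le hbb'
  have hd : 0 < d := hb'.trans hbd
  have key : ∀ k : ℝ, 0 < k → ∀ x y : ℝ, 0 < x → x < y →
      Real.log (y ^ k - x ^ k) = Real.log 2 + k / 2 * (Real.log x + Real.log y) +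
        Real.log (Real.sinh (k * ((Real.log y - Real.log x) / 2))) := by
    intro k hk x y hx hxy
    have hy := hx.trans hxy
    have hlog : Real.log x < Real.log y := Real.log_lt_log hx hxy
    have e : y ^ k - x ^ k = 2 * Real.exp (k / 2 * (Real.log x + Real.log y)) *
        Real.sinh (k * ((Real.log y - Real.log x) / 2)) := by
      rw [Real.sinh_eq, Real.rpow_def_of_pos hy, Real.rpow_def_of_pos hx]
      have : ∀ E p q : ℝ, 2 * E * ((p - q) / 2) = E * p - E * q := by intros; ring
      rw [this, ← Real.exp_add, ← Real.exp_add]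
      congr 2 <;> ring
    have hsh : 0 < Real.sinh (k * ((Real.log y - Real.log x) / 2)) :=
      Real.sinh_pos_iff.2 (mul_pos hk (by linarith))
    rw [e, Real.log_mul (by positivity) hsh.ne', Real.log_mul (by norm_num) (by positivity),
      Real.log_exp]
  have h1 : ∀ x y : ℝ, 0 < x → x < y → Real.log (y - x) = Real.log 2 +
      1 / 2 * (Real.log x + Real.log y) + Real.log (Real.sinh ((Real.log y - Real.log x) / 2)) := by
    intro x y hx hxy
    have := key 1 one_pos x y hx hxy
    simpa using this
  have hmono : ∀ x y x' y' : ℝ, 0 < x → x < y → 0 < x' → x' < y' →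
      Real.log y - Real.log x ≤ Real.log y' - Real.log x' →
      Real.log (Real.sinh (l * ((Real.log y - Real.log x) / 2))) -
        Real.log (Real.sinh ((Real.log y - Real.log x) / 2)) ≤
      Real.log (Real.sinh (l * ((Real.log y' - Real.log x') / 2))) -
        Real.log (Real.sinh ((Real.log y' - Real.log x') / 2)) := by
    intro x y x' y' hx hxy hx' hxy' h
    have p1 : 0 < (Real.log y - Real.log x) / 2 := by
      have := Real.log_lt_log hx hxy; linarith
    have p2 : 0 < (Real.log y' - Real.log x') / 2 := by
      have := Real.log_lt_log hx' hxy'; linarith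
    have s1 := Real.sinh_pos_iff.2 p1
    have s2 := Real.sinh_pos_iff.2 p2
    have s3 := Real.sinh_pos_iff.2 (mul_pos hl0 p1)
    have s4 := Real.sinh_pos_iff.2 (mul_pos hl0 p2)
    rw [← Real.log_div s3.ne' s1.ne', ← Real.log_div s4.ne' s2.ne']
    exact Real.log_le_log (by positivity)
      (sinh_mul_div_sinh_mono hl (mem_Ioi.2 p1) (mem_Ioi.2 p2) (by linarith))
  have lab := Real.log_le_log ha hab.le
  have lbb := Real.log_le_log hb hbb'
  have lbd := Real.log_le_log hb' hbd.le
  have m1 := hmono a b a b' ha hab ha (hab.trans_le hbb') (by linarith)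
  have m2 := hmono b' d b d hb' hbd hb (hbb'.trans_lt hbd) (by linarith)
  unfold crossLog
  rw [key l hl0 a b' ha (hab.trans_le hbb'), key l hl0 b d hb (hbb'.trans_lt hbd),
    key l hl0 a b ha hab, key l hl0 b' d hb' hbd, h1 a b' ha (hab.trans_le hbb'),
    h1 b d hb (hbb'.trans_lt hbd), h1 a b ha hab, h1 b' d hb' hbd]
  linarith

lemma crossLog_le_rpow {l : ℝ} (hl : 1 < l) {a b b' d : ℝ} (ha : 0 ≤ a) (hab : a < b)
    (hbb' : b ≤ b') (hbd : b' < d) :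
    crossLog a b b' d ≤ crossLog (a ^ l) (b ^ l) (b' ^ l) (d ^ l) := by
  rcases ha.lt_or_eq with ha | rfl
  · exact crossLog_le_rpow_of_pos hl ha hab hbb' hbd
  have hl0 : 0 < l := by linarith
  have hb' : 0 < b' := hab.trans_le hbb'
  have t1 : Tendsto (fun a => crossLog a b b' d) (𝓝[>] 0) (𝓝 (crossLog 0 b b' d)) := by
    have : ContinuousAt (fun a => crossLog a b b' d) 0 := by
      unfold crossLog
      have h1 : b' - 0 ≠ 0 := by simpa using hb'.ne'
      have h2 : b - 0 ≠ 0 := by simpa using hab.ne'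
      fun_prop (disch := assumption)
    exact this.tendsto.mono_left nhdsWithin_le_nhds
  have t2 : Tendsto (fun a => crossLog (a ^ l) (b ^ l) (b' ^ l) (d ^ l)) (𝓝[>] 0)
      (𝓝 (crossLog (0 ^ l) (b ^ l) (b' ^ l) (d ^ l))) := by
    have h0 : ContinuousAt (fun a : ℝ => a ^ l) 0 :=
      Real.continuousAt_rpow_const 0 l (Or.inr hl0.le)
    have h3 : ContinuousAt (fun a => crossLog a (b ^ l) (b' ^ l) (d ^ l)) ((0:ℝ) ^ l) := by
      rw [Real.zero_rpow hl0.ne']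
      unfold crossLog
      have h1 : b' ^ l - 0 ≠ 0 := by simpa using (Real.rpow_pos_of_pos hb' l).ne'
      have h2 : b ^ l - 0 ≠ 0 := by simpa using (Real.rpow_pos_of_pos hab l).ne'
      fun_prop (disch := assumption)
    exact (ContinuousAt.comp (f := fun a : ℝ => a ^ l) h3 h0).tendsto.mono_left
      nhdsWithin_le_nhds
  refine le_of_tendsto_of_tendsto t1 t2 ?_
  filter_upwards [Ioo_mem_nhdsGT hab] with x hx
  exact crossLog_le_rpow_of_pos hl hx.1 hx.2 hbb' hbd

/-- On `S`, the map `f` is Lipschitz and contracts the logarithm of cross ratios at most by an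
additive error `C * |d - a| * |b' - b|`. -/
def HasCrossBound (f : ℝ → ℝ) (S : Set ℝ) : Prop :=
  ∃ C ≥ 0, ∃ M ≥ 0, (∀ x ∈ S, ∀ y ∈ S, |f x - f y| ≤ M * |x - y|) ∧
    ∀ a ∈ S, ∀ b ∈ S, ∀ b' ∈ S, ∀ d ∈ S, a < b → b ≤ b' → b' < d →
      crossLog a b b' d ≤ crossLog (f a) (f b) (f b') (f d) + C * ((d - a) * (b' - b))

lemma HasCrossBound.mono {f : ℝ → ℝ} {S S' : Set ℝ} (h : HasCrossBound f S) (hS : S' ⊆ S) :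
    HasCrossBound f S' := by
  obtain ⟨C, hC, M, hM, h1, h2⟩ := h
  exact ⟨C, hC, M, hM, fun x hx y hy => h1 x (hS hx) y (hS hy),
    fun a ha b hb b' hb' d hd => h2 a (hS ha) b (hS hb) b' (hS hb') d (hS hd)⟩

lemma HasCrossBound.of_contDiffOn {g : ℝ → ℝ} {p q : ℝ} (hpq : p < q)
    (hg : ContDiffOn ℝ 3 g (Icc p q)) (hne : ∀ x ∈ Icc p q, derivWithin g (Icc p q) x ≠ 0) :
    HasCrossBound g (Icc p q) := by
  obtain ⟨C, hC, -, -, M, hM, -, h2, h3⟩ := exists_crossLog_le_of_contDiffOn hpq hg hne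
  refine ⟨C, hC, M, hM.le, h2, fun a ha b hb b' hb' d hd h h' h'' => ?_⟩
  have := h3 a ha b hb b' hb' d hd h.ne (h.trans_le h').ne (h'.trans_lt h'').ne' h''.ne'
  rwa [abs_of_nonneg (by linarith), abs_of_nonneg (by linarith), mul_assoc] at this

lemma HasCrossBound.of_rpow {f φ ψ : ℝ → ℝ} {l s η : ℝ} (hl : 1 < l) (hs : |s| = 1)
    (hη : 0 < η) (hη1 : η ≤ 1) (hφ : ContDiffOn ℝ 3 φ (Icc 0 η))
    (hφ' : ∀ x ∈ Icc 0 η, derivWithin φ (Icc 0 η) x ≠ 0)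
    (hψ : ContDiffOn ℝ 3 ψ (Icc (-η) η))
    (hψ' : ∀ x ∈ Icc (-η) η, derivWithin ψ (Icc (-η) η) x ≠ 0)
    (hf : ∀ x ∈ Icc 0 η, f (φ x) = ψ (s * x ^ l)) :
    HasCrossBound f (φ '' Icc 0 η) := by
  have hl0 : 0 < l := by linarith
  obtain ⟨C₁, hC₁, κ, hκ, -, -, k1, -, k3⟩ := exists_crossLog_le_of_contDiffOn hη hφ hφ'
  obtain ⟨C₂, hC₂, -, -, M, hM, -, m2, m3⟩ :=
    exists_crossLog_le_of_contDiffOn (by linarith : -η < η) hψ hψ'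
  obtain ⟨L₀, hL₀⟩ := lipschitz_of_contDiffOn_one hη
    (Real.contDiff_rpow_const_of_le (p := l) (n := 1) (by simpa using hl.le)).contDiffOn
  set L := max L₀ 0
  have hL0 : 0 ≤ L := le_max_right _ _
  have hL : ∀ x ∈ Icc 0 η, ∀ y ∈ Icc 0 η, |x ^ l - y ^ l| ≤ L * |x - y| := fun x hx y hy =>
    (hL₀ x hx y hy).trans (mul_le_mul_of_nonneg_right (le_max_left _ _) (abs_nonneg _))
  have hpow : ∀ x ∈ Icc 0 η, s * x ^ l ∈ Icc (-η) η := by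
    intro x hx
    rw [mem_Icc, ← abs_le, abs_mul, hs, one_mul, abs_of_nonneg (Real.rpow_nonneg hx.1 _)]
    refine (Real.rpow_le_rpow_of_exponent_ge' hx.1 (hx.2.trans hη1) zero_le_one hl.le).trans ?_
    simpa using hx.2
  have hsub : ∀ x ∈ Icc 0 η, ∀ y ∈ Icc 0 η, |s * x ^ l - s * y ^ l| ≤ L * |x - y| := by
    intro x hx y hy
    rw [← mul_sub, abs_mul, hs, one_mul]
    exact hL x hx y hy
  have hdiv : ∀ x ∈ Icc 0 η, ∀ y ∈ Icc 0 η, |x - y| ≤ |φ x - φ y| / κ := by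
    intro x hx y hy
    rw [le_div_iff₀ hκ, mul_comm]
    exact k1 x hx y hy
  have hinj : InjOn φ (Icc 0 η) := by
    intro x hx y hy hxy
    have := k1 x hx y hy
    rw [hxy, sub_self, abs_zero] at this
    have h0 : |x - y| ≤ 0 := by
      by_contra! h
      nlinarith [mul_pos hκ h]
    exact sub_eq_zero.1 (abs_nonpos_iff.1 h0)
  have hne : ∀ x ∈ Icc 0 η, ∀ y ∈ Icc 0 η, φ x ≠ φ y → s * x ^ l ≠ s * y ^ l := by
    intro x hx y hy hxy h
    have hs0 : s ≠ 0 := by rintro rfl; simp at hs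
    exact hxy (congrArg φ (Real.rpow_left_injOn hl0.ne' hx.1 hy.1 (mul_left_cancel₀ hs0 h)))
  have hmid : ∀ x ∈ Icc 0 η, ∀ y ∈ Icc 0 η, ∀ y' ∈ Icc 0 η, ∀ z ∈ Icc 0 η,
      φ x < φ y → φ y ≤ φ y' → φ y' < φ z →
      crossLog x y y' z ≤ crossLog (s * x ^ l) (s * y ^ l) (s * y' ^ l) (s * z ^ l) := by
    intro x hx y hy y' hy' z hz h1 h2 h3
    have hsc : crossLog (s * x ^ l) (s * y ^ l) (s * y' ^ l) (s * z ^ l) =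
        crossLog (x ^ l) (y ^ l) (y' ^ l) (z ^ l) := by
      rcases eq_or_eq_neg_of_abs_eq hs with rfl | rfl
      · simp only [one_mul]
      · simp only [neg_mul, one_mul, crossLog_neg]
    rw [hsc]
    rcases ContinuousOn.strictMonoOn_of_injOn_Icc' hη.le hφ.continuousOn hinj with h | h
    · exact crossLog_le_rpow hl hx.1 ((h.lt_iff_lt hx hy).1 h1) ((h.le_iff_le hy hy').1 h2)
        ((h.lt_iff_lt hy' hz).1 h3)
    · rw [← crossLog_rev, ← crossLog_rev (x ^ l)]
      exact crossLog_le_rpow hl hz.1 ((h.lt_iff_gt hy' hz).1 h3) ((h.le_iff_ge hy hy').1 h2)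
        ((h.lt_iff_gt hx hy).1 h1)
  refine ⟨C₁ / κ ^ 2 + C₂ * L ^ 2 / κ ^ 2, by positivity, M * L / κ, by positivity, ?_, ?_⟩
  · rintro _ ⟨x, hx, rfl⟩ _ ⟨y, hy, rfl⟩
    rw [hf x hx, hf y hy]
    calc _ ≤ M * |s * x ^ l - s * y ^ l| := m2 _ (hpow x hx) _ (hpow y hy)
      _ ≤ M * (L * (|φ x - φ y| / κ)) := by
          gcongr
          exact (hsub x hx y hy).trans (mul_le_mul_of_nonneg_left (hdiv x hx y hy) hL0)
      _ = _ := by ring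
  · rintro _ ⟨x, hx, rfl⟩ _ ⟨y, hy, rfl⟩ _ ⟨y', hy', rfl⟩ _ ⟨z, hz, rfl⟩ h1 h2 h3
    have n1 : φ x ≠ φ y := h1.ne
    have n2 : φ x ≠ φ y' := (h1.trans_le h2).ne
    have n3 : φ z ≠ φ y := (h2.trans_lt h3).ne'
    have n4 : φ z ≠ φ y' := h3.ne'
    have e1 := k3 x hx y' hy' y hy z hz (ne_of_apply_ne φ n2) (ne_of_apply_ne φ n1)
      (ne_of_apply_ne φ n4) (ne_of_apply_ne φ n3)
    rw [crossLog_swap, crossLog_swap (φ x)] at e1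
    have e2 := m3 _ (hpow x hx) _ (hpow y hy) _ (hpow y' hy') _ (hpow z hz)
      (hne x hx y hy n1) (hne x hx y' hy' n2) (hne z hz y hy n3) (hne z hz y' hy' n4)
    have e3 := hmid x hx y hy y' hy' z hz h1 h2 h3
    rw [← hf x hx, ← hf y hy, ← hf y' hy', ← hf z hz] at e2
    have d1 := hdiv z hz x hx
    have d2 := hdiv y' hy' y hy
    have d3 := hsub z hz x hx
    have d4 := hsub y' hy' y hy
    rw [abs_of_nonneg (a := φ z - φ x) (by linarith)] at d1
    rw [abs_of_nonneg (a := φ y' - φ y) (by linarith)] at d2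
    have hzx : 0 ≤ (φ z - φ x) / κ := div_nonneg (by linarith) hκ.le
    have hyy : 0 ≤ (φ y' - φ y) / κ := div_nonneg (by linarith) hκ.le
    have f1 : C₁ * |z - x| * |y - y'| ≤ C₁ * ((φ z - φ x) / κ) * ((φ y' - φ y) / κ) := by
      rw [abs_sub_comm y y']
      gcongr
    have f2 : C₂ * |s * z ^ l - s * x ^ l| * |s * y' ^ l - s * y ^ l| ≤
        C₂ * (L * ((φ z - φ x) / κ)) * (L * ((φ y' - φ y) / κ)) := by
      gcongr
      · exact d3.trans (mul_le_mul_of_nonneg_left d1 hL0)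
      · exact d4.trans (mul_le_mul_of_nonneg_left d2 hL0)
    have f3 : (C₁ / κ ^ 2 + C₂ * L ^ 2 / κ ^ 2) * ((φ z - φ x) * (φ y' - φ y)) =
        C₁ * ((φ z - φ x) / κ) * ((φ y' - φ y) / κ) +
        C₂ * (L * ((φ z - φ x) / κ)) * (L * ((φ y' - φ y) / κ)) := by
      field_simp
    rw [f3]
    linarith

lemma exists_Icc_contDiffOn {φ : ℝ → ℝ} {U : Set ℝ} (hU : U ∈ 𝓝 (0:ℝ))
    (hφ : ContDiffOn ℝ 3 φ U) (hφ' : deriv φ 0 ≠ 0) :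
    ∃ η > 0, ∀ p q : ℝ, p < q → -η < p → q < η →
      ContDiffOn ℝ 3 φ (Icc p q) ∧ ∀ x ∈ Icc p q, derivWithin φ (Icc p q) x ≠ 0 := by
  have h0 : ContDiffAt ℝ 3 φ 0 := hφ.contDiffAt hU
  have h1 : ∀ᶠ x in 𝓝 (0:ℝ), ContDiffAt ℝ 3 φ x := h0.eventually (by decide)
  have h2 : ContinuousAt (deriv φ) 0 :=
    (ContDiffAt.derivWithin (m := 2) h0 (by norm_num)).continuousAt
  have h3 : ∀ᶠ x in 𝓝 (0:ℝ), deriv φ x ≠ 0 := h2.eventually_ne hφ'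
  obtain ⟨η, hη, h⟩ := Metric.eventually_nhds_iff.1 (h1.and h3)
  refine ⟨η, hη, fun p q hpq hp hq => ?_⟩
  have h' : ∀ x ∈ Icc p q, ContDiffAt ℝ 3 φ x ∧ deriv φ x ≠ 0 := by
    intro x hx
    apply h
    rw [Real.dist_eq, sub_zero, abs_lt]
    exact ⟨by linarith [hx.1], by linarith [hx.2]⟩
  refine ⟨fun x hx => (h' x hx).1.contDiffWithinAt, fun x hx => ?_⟩
  rw [((h' x hx).1.differentiableAt (by norm_num)).derivWithin (uniqueDiffOn_Icc hpq x hx)]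
  exact (h' x hx).2

lemma exists_hasCrossBound_nonflat {f φ ψ : ℝ → ℝ} {c l s : ℝ} {U : Set ℝ} (hl : 1 < l)
    (hφ0 : φ 0 = c) (hU : U ∈ 𝓝 (0:ℝ)) (hφ : ContDiffOn ℝ 3 φ U)
    (hψ : ContDiffOn ℝ 3 ψ U) (hφ' : deriv φ 0 ≠ 0) (hψ' : deriv ψ 0 ≠ 0) (hs : |s| = 1)
    (hf : ∀ᶠ x in 𝓝 (0:ℝ), f (φ x) = ψ (s * |x| ^ l)) :
    ∃ ρ > 0, HasCrossBound f (Icc c (c + ρ)) ∧ HasCrossBound f (Icc (c - ρ) c) := by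
  obtain ⟨η₁, hη₁, h1⟩ := exists_Icc_contDiffOn hU hφ hφ'
  obtain ⟨η₂, hη₂, h2⟩ := exists_Icc_contDiffOn hU hψ hψ'
  have hneg : Tendsto (fun x : ℝ => -x) (𝓝 0) (𝓝 0) := by
    simpa using (continuous_neg (G := ℝ)).tendsto 0
  obtain ⟨η₃, hη₃, h3⟩ := exists_Icc_contDiffOn (φ := fun x => φ (-x)) (hneg hU)
    (hφ.comp contDiff_neg.contDiffOn fun x hx => hx) (by
      rw [deriv_comp_neg]; simpa using hφ')
  obtain ⟨η₄, hη₄, h4⟩ := Metric.eventually_nhds_iff.1 hf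
  obtain ⟨η, hη, hη'⟩ : ∃ η > 0, η < min (min (min η₁ η₂) (min η₃ η₄)) 1 :=
    exists_between (by positivity)
  simp only [lt_min_iff] at hη'
  obtain ⟨⟨⟨l1, l2⟩, l3, l4⟩, l5⟩ := hη'
  obtain ⟨g1, g2⟩ := h1 (-η) η (by linarith) (by linarith) l1
  obtain ⟨-, -, κ, hκ, -, -, k1, -⟩ := exists_crossLog_le_of_contDiffOn (by linarith) g1 g2
  have hinj : InjOn φ (Icc (-η) η) := by
    intro x hx y hy hxy
    have := k1 x hx y hy
    rw [hxy, sub_self, abs_zero] at this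
    have h0 : |x - y| ≤ 0 := by
      by_contra! h
      nlinarith [mul_pos hκ h]
    exact sub_eq_zero.1 (abs_nonpos_iff.1 h0)
  obtain ⟨p1, p2⟩ := h2 (-η) η (by linarith) (by linarith) l2
  have q1 : ∀ x ∈ Icc 0 η, f (φ x) = ψ (s * x ^ l) := by
    intro x hx
    rw [h4 (by rw [Real.dist_eq, sub_zero, abs_of_nonneg hx.1]; linarith [hx.2]),
      abs_of_nonneg hx.1]
  have q2 : ∀ x ∈ Icc 0 η, f (φ (-x)) = ψ (s * x ^ l) := by
    intro x hx
    rw [h4 (by rw [Real.dist_eq, sub_zero, abs_neg, abs_of_nonneg hx.1]; linarith [hx.2]),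
      abs_neg, abs_of_nonneg hx.1]
  obtain ⟨r1, r2⟩ := h1 0 η hη (by linarith) l1
  obtain ⟨r3, r4⟩ := h3 0 η hη (by linarith) l3
  have b1 := HasCrossBound.of_rpow hl hs hη l5.le r1 r2 p1 p2 q1
  have b2 := HasCrossBound.of_rpow hl hs hη l5.le r3 r4 p1 p2 q2
  have i1 : uIcc c (φ η) ⊆ φ '' Icc 0 η := by
    have := intermediate_value_uIcc (f := φ) (a := 0) (b := η)
      (by rw [uIcc_of_le hη.le]; exact r1.continuousOn)
    rwa [hφ0, uIcc_of_le hη.le] at this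
  have i2 : uIcc c (φ (-η)) ⊆ (fun x => φ (-x)) '' Icc 0 η := by
    have := intermediate_value_uIcc (f := fun x => φ (-x)) (a := 0) (b := η)
      (by rw [uIcc_of_le hη.le]; exact r3.continuousOn)
    simpa only [neg_zero, hφ0, uIcc_of_le hη.le] using this
  have m0 : (0:ℝ) ∈ Icc (-η) η := ⟨by linarith, hη.le⟩
  have m1 : η ∈ Icc (-η) η := ⟨by linarith, le_rfl⟩
  have m2 : -η ∈ Icc (-η) η := ⟨le_rfl, by linarith⟩
  rcases ContinuousOn.strictMonoOn_of_injOn_Icc' (by linarith) g1.continuousOn hinj with h | h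
  · have u1 : c < φ η := hφ0 ▸ h m0 m1 hη
    have u2 : φ (-η) < c := hφ0 ▸ h m2 m0 (by linarith)
    rw [uIcc_of_le u1.le] at i1
    rw [uIcc_of_ge u2.le] at i2
    refine ⟨min (φ η - c) (c - φ (-η)), lt_min (by linarith) (by linarith),
      b1.mono ((Icc_subset_Icc le_rfl ?_).trans i1), b2.mono ((Icc_subset_Icc ?_ le_rfl).trans i2)⟩
    · linarith [min_le_left (φ η - c) (c - φ (-η))]
    · linarith [min_le_right (φ η - c) (c - φ (-η))]
  · have u1 : φ η < c := hφ0 ▸ h m0 m1 hη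
    have u2 : c < φ (-η) := hφ0 ▸ h m2 m0 (by linarith)
    rw [uIcc_of_ge u1.le] at i1
    rw [uIcc_of_le u2.le] at i2
    refine ⟨min (c - φ η) (φ (-η) - c), lt_min (by linarith) (by linarith),
      b2.mono ((Icc_subset_Icc le_rfl ?_).trans i2), b1.mono ((Icc_subset_Icc ?_ le_rfl).trans i1)⟩
    · linarith [min_le_right (c - φ η) (φ (-η) - c)]
    · linarith [min_le_left (c - φ η) (φ (-η) - c)]

lemma HasCrossBound.neg {f : ℝ → ℝ} {S : Set ℝ} (h : HasCrossBound f S) :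
    HasCrossBound (fun x => -f x) S := by
  obtain ⟨C, hC, M, hM, h1, h2⟩ := h
  refine ⟨C, hC, M, hM, fun x hx y hy => ?_, fun a ha b hb b' hb' d hd => ?_⟩
  · rw [neg_sub_neg, abs_sub_comm]
    exact h1 x hx y hy
  · rw [crossLog_neg]
    exact h2 a ha b hb b' hb' d hd

lemma HasCrossBound.comp_neg {f : ℝ → ℝ} {p q : ℝ} (h : HasCrossBound f (Icc p q)) :
    HasCrossBound (fun x => f (-x)) (Icc (-q) (-p)) := by
  obtain ⟨C, hC, M, hM, h1, h2⟩ := h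
  have hm : ∀ x ∈ Icc (-q) (-p), -x ∈ Icc p q := fun x hx =>
    ⟨by linarith [hx.2], by linarith [hx.1]⟩
  refine ⟨C, hC, M, hM, fun x hx y hy => ?_, fun a ha b hb b' hb' d hd e1 e2 e3 => ?_⟩
  · have := h1 _ (hm x hx) _ (hm y hy)
    rwa [neg_sub_neg, abs_sub_comm y] at this
  · have := h2 _ (hm d hd) _ (hm b' hb') _ (hm b hb) _ (hm a ha) (by linarith) (by linarith)
      (by linarith)
    rw [crossLog_neg, crossLog_rev a b b' d, crossLog_rev (f (-a))] at this
    refine this.trans_eq ?_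
    ring

lemma crossLog_le_of_le_right {f : ℝ → ℝ} {p q e₂ e₃ : ℝ} (hf : StrictMonoOn f (Icc p q))
    (hpe : p ≤ e₂) (he : e₂ < e₃) (heq : e₃ ≤ q) (h : HasCrossBound f (Icc p e₃)) :
    ∃ C ≥ 0, ∀ a ∈ Icc p q, ∀ b ∈ Icc p q, ∀ b' ∈ Icc p q, ∀ d ∈ Icc p q,
      a < b → b ≤ b' → b' < d → b' ≤ e₂ →
      crossLog a b b' d ≤ crossLog (f a) (f b) (f b') (f d) + C * ((d - a) * (b' - b)) := by
  obtain ⟨C, hC, M, hM, h1, h2⟩ := h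
  have m2 : e₂ ∈ Icc p q := ⟨hpe, by linarith⟩
  have m3 : e₃ ∈ Icc p q := ⟨by linarith, heq⟩
  have hκ : 0 < f e₃ - f e₂ := sub_pos.2 (hf m2 m3 he)
  have hee : 0 < e₃ - e₂ := sub_pos.2 he
  refine ⟨C + M / ((f e₃ - f e₂) * (e₃ - e₂)), by positivity, ?_⟩
  intro a ha b hb b' hb' d hd hab hbb hbd hbe
  have k1 : 0 ≤ (d - a) * (b' - b) := mul_nonneg (by linarith) (by linarith)
  have na : a ∈ Icc p e₃ := ⟨ha.1, by linarith⟩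
  have nb : b ∈ Icc p e₃ := ⟨hb.1, by linarith⟩
  have nb' : b' ∈ Icc p e₃ := ⟨hb'.1, by linarith⟩
  rcases le_or_gt d e₃ with hde | hde
  · have := h2 a na b nb b' nb' d ⟨hd.1, hde⟩ hab hbb hbd
    have k2 : 0 ≤ M / ((f e₃ - f e₂) * (e₃ - e₂)) * ((d - a) * (b' - b)) := by positivity
    rw [add_mul]
    linarith
  · have hlog : ∀ x y u v : ℝ, x ≤ y → y < u → u ≤ v →
        Real.log (v - x) - Real.log (v - y) ≤ Real.log (u - x) - Real.log (u - y) := by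
      intro x y u v hxy hyu huv
      rw [← Real.log_div (by linarith) (by linarith), ← Real.log_div (by linarith) (by linarith)]
      refine Real.log_le_log (div_pos (by linarith) (by linarith)) ?_
      rw [div_le_div_iff₀ (by linarith) (by linarith)]
      nlinarith [mul_nonneg (sub_nonneg.2 hxy) (sub_nonneg.2 huv)]
    have t1 := h2 a na b nb b' nb' e₃ ⟨by linarith, le_rfl⟩ hab hbb (by linarith)
    have t2 := hlog b b' e₃ d hbb (by linarith) hde.le
    have fbb : f b ≤ f b' := (hf.le_iff_le hb hb').2 hbb
    have fbd : f b' < f d := hf hb' hd hbd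
    have fbe : f b' ≤ f e₂ := (hf.le_iff_le hb' m2).2 hbe
    have t3 : Real.log (f d - f b') ≤ Real.log (f d - f b) :=
      Real.log_le_log (by linarith) (by linarith)
    have t4 : Real.log (f e₃ - f b) - Real.log (f e₃ - f b') ≤
        M * (b' - b) / (f e₃ - f e₂) := by
      rw [← Real.log_div (by linarith) (by linarith)]
      have p1 : 0 < f e₃ - f b' := by linarith
      have e : (f e₃ - f b) / (f e₃ - f b') = 1 + (f b' - f b) / (f e₃ - f b') := by
        field_simp
        ring
      have := Real.log_le_sub_one_of_pos
        (show 0 < (f e₃ - f b) / (f e₃ - f b') from div_pos (by linarith) p1)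
      have lip : f b' - f b ≤ M * (b' - b) := by
        have := h1 b' nb' b nb
        rwa [abs_of_nonneg (by linarith), abs_of_nonneg (by linarith)] at this
      calc _ ≤ (f b' - f b) / (f e₃ - f b') := by linarith
        _ ≤ _ := div_le_div₀ (mul_nonneg hM (by linarith)) lip hκ (by linarith)
    have t5 : M * (b' - b) / (f e₃ - f e₂) ≤
        M / ((f e₃ - f e₂) * (e₃ - e₂)) * ((d - a) * (b' - b)) := by
      have : M * (b' - b) / (f e₃ - f e₂) =
          M / ((f e₃ - f e₂) * (e₃ - e₂)) * ((e₃ - e₂) * (b' - b)) := by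
        field_simp
      rw [this]
      refine mul_le_mul_of_nonneg_left (mul_le_mul_of_nonneg_right ?_ (by linarith))
        (by positivity)
      linarith
    have t6 : C * ((e₃ - a) * (b' - b)) ≤ C * ((d - a) * (b' - b)) :=
      mul_le_mul_of_nonneg_left (mul_le_mul_of_nonneg_right (by linarith) (by linarith)) hC
    unfold crossLog at t1 ⊢
    rw [add_mul]
    linarith

lemma HasCrossBound.union_of_strictMonoOn {f : ℝ → ℝ} {p q e₁ e₂ e₃ : ℝ}
    (hf : StrictMonoOn f (Icc p q)) (hpe : p ≤ e₁) (h12 : e₁ < e₂) (h23 : e₂ < e₃) (heq : e₃ ≤ q)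
    (hl : HasCrossBound f (Icc p e₃)) (hr : HasCrossBound f (Icc e₁ q)) :
    HasCrossBound f (Icc p q) := by
  obtain ⟨C₁, hC₁, b1⟩ := crossLog_le_of_le_right hf (by linarith) h23 heq hl
  have hf' : StrictMonoOn (fun x => -f (-x)) (Icc (-q) (-p)) := fun x hx y hy hxy =>
    neg_lt_neg (hf ⟨by linarith [hy.2], by linarith [hy.1]⟩
      ⟨by linarith [hx.2], by linarith [hx.1]⟩ (by linarith))
  obtain ⟨C₂, hC₂, b2⟩ := crossLog_le_of_le_right hf' (by linarith : -q ≤ -e₂)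
    (neg_lt_neg h12) (by linarith) hr.comp_neg.neg
  have b3 : ∀ a ∈ Icc p q, ∀ b ∈ Icc p q, ∀ b' ∈ Icc p q, ∀ d ∈ Icc p q,
      a < b → b ≤ b' → b' < d → e₂ ≤ b →
      crossLog a b b' d ≤ crossLog (f a) (f b) (f b') (f d) + C₂ * ((d - a) * (b' - b)) := by
    intro a ha b hb b' hb' d hd u1 u2 u3 u4
    have hm : ∀ x ∈ Icc p q, -x ∈ Icc (-q) (-p) := fun x hx =>
      ⟨by linarith [hx.2], by linarith [hx.1]⟩
    have := b2 _ (hm d hd) _ (hm b' hb') _ (hm b hb) _ (hm a ha) (by linarith) (by linarith)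
      (by linarith) (by linarith)
    simp only [neg_neg] at this
    rw [crossLog_neg, crossLog_neg, crossLog_rev a b b' d, crossLog_rev (f a)] at this
    refine this.trans_eq ?_
    ring
  obtain ⟨-, -, M₁, hM₁, l1, -⟩ := hl
  obtain ⟨-, -, M₂, hM₂, l2, -⟩ := hr
  have lip : ∀ x ∈ Icc p q, ∀ y ∈ Icc p q, x ≤ y → |f x - f y| ≤ (M₁ + M₂) * |x - y| := by
    intro x hx y hy hxy
    rcases le_or_gt y e₃ with h | h
    · refine (l1 x ⟨hx.1, by linarith⟩ y ⟨hy.1, h⟩).trans ?_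
      exact mul_le_mul_of_nonneg_right (by linarith) (abs_nonneg _)
    rcases le_or_gt e₁ x with h' | h'
    · refine (l2 x ⟨h', hx.2⟩ y ⟨by linarith, hy.2⟩).trans ?_
      exact mul_le_mul_of_nonneg_right (by linarith) (abs_nonneg _)
    have v1 := l1 x ⟨hx.1, by linarith⟩ e₂ ⟨by linarith, by linarith⟩
    have v2 := l2 e₂ ⟨by linarith, by linarith⟩ y ⟨by linarith, hy.2⟩
    have v3 := abs_sub_le (f x) (f e₂) (f y)
    rw [abs_of_nonpos (a := x - e₂) (by linarith)] at v1
    rw [abs_of_nonpos (a := e₂ - y) (by linarith)] at v2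
    rw [abs_of_nonpos (a := x - y) (by linarith)]
    nlinarith [mul_nonneg hM₁ (by linarith : 0 ≤ y - e₂), mul_nonneg hM₂ (by linarith : 0 ≤ e₂ - x)]
  refine ⟨C₁ + C₂, by positivity, M₁ + M₂, by positivity, fun x hx y hy => ?_, ?_⟩
  · rcases le_total x y with h | h
    · exact lip x hx y hy h
    · rw [abs_sub_comm, abs_sub_comm x]
      exact lip y hy x hx h
  · intro a ha b hb b' hb' d hd u1 u2 u3
    have k : 0 ≤ (d - a) * (b' - b) := mul_nonneg (by linarith) (by linarith)
    rcases le_or_gt b' e₂ with h | h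
    · have := b1 a ha b hb b' hb' d hd u1 u2 u3 h
      nlinarith [mul_nonneg hC₂ k]
    rcases le_or_gt e₂ b with h' | h'
    · have := b3 a ha b hb b' hb' d hd u1 u2 u3 h'
      nlinarith [mul_nonneg hC₁ k]
    have me : e₂ ∈ Icc p q := ⟨by linarith, by linarith⟩
    have w1 := b1 a ha b hb e₂ me d hd u1 h'.le (by linarith) le_rfl
    have w2 := b3 a ha e₂ me b' hb' d hd (by linarith) h.le u3 le_rfl
    rw [← crossLog_add a b e₂ b' d, ← crossLog_add (f a) (f b) (f e₂) (f b') (f d)]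
    have k1 : 0 ≤ C₁ * ((d - a) * (b' - e₂)) :=
      mul_nonneg hC₁ (mul_nonneg (by linarith) (by linarith))
    have k2 : 0 ≤ C₂ * ((d - a) * (e₂ - b)) :=
      mul_nonneg hC₂ (mul_nonneg (by linarith) (by linarith))
    nlinarith

lemma HasCrossBound.union_of_strictAntiOn {f : ℝ → ℝ} {p q e₁ e₂ e₃ : ℝ}
    (hf : StrictAntiOn f (Icc p q)) (hpe : p ≤ e₁) (h12 : e₁ < e₂) (h23 : e₂ < e₃) (heq : e₃ ≤ q)
    (hl : HasCrossBound f (Icc p e₃)) (hr : HasCrossBound f (Icc e₁ q)) :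
    HasCrossBound f (Icc p q) := by
  have := (HasCrossBound.union_of_strictMonoOn (f := fun x => -f x)
    (fun x hx y hy hxy => neg_lt_neg (hf hx hy hxy)) hpe h12 h23 heq hl.neg hr.neg).neg
  simpa only [neg_neg] using this

lemma derivWithin_Icc_ne_zero {f : ℝ → ℝ} {p q x : ℝ} (hpq : p < q) (hx : x ∈ Icc p q)
    (h : deriv f x ≠ 0) : derivWithin f (Icc p q) x ≠ 0 := by
  rwa [(differentiableAt_of_deriv_ne_zero h).derivWithin (uniqueDiffOn_Icc hpq x hx)]

lemma UnimodalA.hasCrossBound {f : ℝ → ℝ} {c l : ℝ} (h : UnimodalA f c l) :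
    HasCrossBound f (Icc 0 c) ∧ HasCrossBound f (Icc c 1) := by
  obtain ⟨φ, ψ, hφ0, -, ⟨U, hU, hφ, hψ⟩, hφ', hψ', s, hs, hf⟩ := h.nonflat
  obtain ⟨ρ₀, hρ₀, hr₀, hl₀⟩ :=
    exists_hasCrossBound_nonflat h.ell_gt_one hφ0 hU hφ hψ hφ' hψ' hs hf
  obtain ⟨hc0, hc1⟩ := h.c_mem
  obtain ⟨ρ, hρ, hρ'⟩ : ∃ ρ > 0, ρ < min ρ₀ (min c (1 - c)) :=
    exists_between (lt_min hρ₀ (lt_min hc0 (by linarith)))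
  simp only [lt_min_iff] at hρ'
  obtain ⟨l1, l2, l3⟩ := hρ'
  have hfar : ∀ p q : ℝ, p < q → Icc p q ⊆ Icc 0 1 \ {c} → HasCrossBound f (Icc p q) :=
    fun p q hpq hs => HasCrossBound.of_contDiffOn hpq (h.smooth.mono hs)
      fun x hx => derivWithin_Icc_ne_zero hpq hx (h.deriv_ne x (hs hx))
  constructor
  · refine HasCrossBound.union_of_strictMonoOn (e₁ := c - ρ) (e₂ := c - 2 * ρ / 3)
      (e₃ := c - ρ / 3) h.mono (by linarith) (by linarith) (by linarith) (by linarith) ?_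
      (hl₀.mono (Icc_subset_Icc (by linarith) le_rfl))
    refine hfar _ _ (by linarith) fun x hx => ⟨⟨hx.1, by linarith [hx.2]⟩, ?_⟩
    rintro rfl
    linarith [hx.2]
  · refine HasCrossBound.union_of_strictAntiOn (e₁ := c + ρ / 3) (e₂ := c + 2 * ρ / 3)
      (e₃ := c + ρ) h.anti (by linarith) (by linarith) (by linarith) (by linarith)
      (hr₀.mono (Icc_subset_Icc le_rfl (by linarith))) ?_
    refine hfar _ _ (by linarith) fun x hx => ⟨⟨by linarith [hx.1], hx.2⟩, ?_⟩
    rintro rfl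
    linarith [hx.1]

/-- On intervals of `[0, 1]` that do not contain `c`, the map `f` contracts logarithms of cross
ratios at most by the additive error `C * |d - a| * |b' - b|`. -/
def OneStepCrossBound (f : ℝ → ℝ) (c C : ℝ) : Prop :=
  ∀ a ∈ Icc (0:ℝ) 1, ∀ b ∈ Icc (0:ℝ) 1, ∀ b' ∈ Icc (0:ℝ) 1, ∀ d ∈ Icc (0:ℝ) 1,
    (a < b ∧ b ≤ b' ∧ b' < d ∨ d < b' ∧ b' ≤ b ∧ b < a) → c ∉ Ioo (min a d) (max a d) →
    crossLog a b b' d ≤ crossLog (f a) (f b) (f b') (f d) + C * (|d - a| * |b' - b|)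

lemma UnimodalA.exists_crossLog_le {f : ℝ → ℝ} {c l : ℝ} (h : UnimodalA f c l) :
    ∃ C ≥ 0, OneStepCrossBound f c C := by
  obtain ⟨⟨C₁, hC₁, -, -, -, h1⟩, C₂, hC₂, -, -, -, h2⟩ := h.hasCrossBound
  have key : ∀ a ∈ Icc (0:ℝ) 1, ∀ b ∈ Icc (0:ℝ) 1, ∀ b' ∈ Icc (0:ℝ) 1, ∀ d ∈ Icc (0:ℝ) 1,
      a < b → b ≤ b' → b' < d → c ∉ Ioo a d →
      crossLog a b b' d ≤ crossLog (f a) (f b) (f b') (f d) +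
        (C₁ + C₂) * ((d - a) * (b' - b)) := by
    intro a ha b hb b' hb' d hd u1 u2 u3 hc
    have k : 0 ≤ (d - a) * (b' - b) := mul_nonneg (by linarith) (by linarith)
    rcases le_or_gt c a with h' | h'
    · have := h2 a ⟨h', ha.2⟩ b ⟨by linarith, hb.2⟩ b' ⟨by linarith, hb'.2⟩ d
        ⟨by linarith, hd.2⟩ u1 u2 u3
      nlinarith [mul_nonneg hC₁ k]
    · have h'' : d ≤ c := not_lt.1 fun h'' => hc ⟨h', h''⟩
      have := h1 a ⟨ha.1, by linarith⟩ b ⟨hb.1, by linarith⟩ b' ⟨hb'.1, by linarith⟩ d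
        ⟨hd.1, by linarith⟩ u1 u2 u3
      nlinarith [mul_nonneg hC₂ k]
  refine ⟨C₁ + C₂, by positivity, fun a ha b hb b' hb' d hd hor hc => ?_⟩
  rcases hor with ⟨u1, u2, u3⟩ | ⟨u1, u2, u3⟩
  · rw [min_eq_left (by linarith), max_eq_right (by linarith)] at hc
    rw [abs_of_nonneg (by linarith), abs_of_nonneg (by linarith)]
    exact key a ha b hb b' hb' d hd u1 u2 u3 hc
  · rw [min_eq_right (by linarith), max_eq_left (by linarith)] at hc
    rw [abs_of_nonpos (by linarith), abs_of_nonpos (by linarith)]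
    have := key d hd b' hb' b hb a ha u1 u2 u3 hc
    rw [crossLog_rev a b b' d, crossLog_rev (f a)] at this
    refine this.trans_eq ?_
    ring

section Iterates

variable {f : ℝ → ℝ} {c l : ℝ}

lemma UnimodalA.iterate_mem (h : UnimodalA f c l) (n : ℕ) {x : ℝ} (hx : x ∈ Icc (0:ℝ) 1) :
    f^[n] x ∈ Icc (0:ℝ) 1 :=
  h.maps.iterate n hx

lemma UnimodalA.continuousOn_iterate (h : UnimodalA f c l) (n : ℕ) :
    ContinuousOn f^[n] (Icc 0 1) :=
  h.cont.iterate h.maps n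

lemma iterate_sub_iterate {j r : ℕ} (hjr : j ≤ r) (x : ℝ) : f^[r - j] (f^[j] x) = f^[r] x := by
  rw [← iterate_add_apply, Nat.sub_add_cancel hjr]

lemma le_or_ge_of_notMem_image_Ioo {g : ℝ → ℝ} {u v : ℝ} (hg : ContinuousOn g (Icc u v))
    (hc : c ∉ g '' Ioo u v) : (∀ z ∈ Icc u v, g z ≤ c) ∨ ∀ z ∈ Icc u v, c ≤ g z := by
  by_contra! hcon
  obtain ⟨⟨x, hx, hx'⟩, y, hy, hy'⟩ := hcon
  have hs : uIcc y x ⊆ Icc u v := uIcc_subset_Icc hy hx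
  obtain ⟨w, hw, rfl⟩ := intermediate_value_uIcc (hg.mono hs)
    (show c ∈ uIcc (g y) (g x) from Icc_subset_uIcc ⟨hy'.le, hx'.le⟩)
  have hw' := hs hw
  rcases hw'.1.eq_or_lt with rfl | h1
  · rcases uIcc_eq_union (a := y) (b := x) ▸ hw with h | h
    · have : u = y := le_antisymm hy.1 h.1
      simp [this] at hy'
    · have : u = x := le_antisymm hx.1 h.1
      simp [this] at hx'
  rcases hw'.2.eq_or_lt with rfl | h2
  · rcases uIcc_eq_union (a := y) (b := x) ▸ hw with h | h
    · have := le_antisymm hx.2 h.2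
      simp [this] at hx'
    · have := le_antisymm hy.2 h.2
      simp [this] at hy'
  exact hc ⟨w, ⟨h1, h2⟩, rfl⟩

lemma UnimodalA.injOn_iterate (h : UnimodalA f c l) {u v : ℝ} (huv : Icc u v ⊆ Icc 0 1) :
    ∀ n : ℕ, (∀ j < n, c ∉ f^[j] '' Ioo u v) → InjOn f^[n] (Icc u v)
  | 0, _ => injOn_id _
  | n + 1, hn => by
    have ih := UnimodalA.injOn_iterate h huv n fun j hj => hn j (hj.trans (Nat.lt_succ_self n))
    rw [iterate_succ']
    rcases le_or_ge_of_notMem_image_Ioo ((h.continuousOn_iterate n).mono huv)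
      (hn n (Nat.lt_succ_self n)) with h' | h'
    · exact h.mono.injOn.comp ih fun z hz => ⟨(h.iterate_mem n (huv hz)).1, h' z hz⟩
    · exact h.anti.injOn.comp ih fun z hz => ⟨h' z hz, (h.iterate_mem n (huv hz)).2⟩

lemma UnimodalA.strictMonoOn_or_strictAntiOn (h : UnimodalA f c l) {u v : ℝ} (huv : u ≤ v)
    (hI : Icc u v ⊆ Icc 0 1) {n : ℕ} (hn : InjOn f^[n] (Icc u v)) :
    StrictMonoOn f^[n] (Icc u v) ∨ StrictAntiOn f^[n] (Icc u v) :=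
  ContinuousOn.strictMonoOn_of_injOn_Icc' huv ((h.continuousOn_iterate n).mono hI) hn

lemma IsNiceInterval.isOpen {T : Set ℝ} (hT : IsNiceInterval f T) : IsOpen T := by
  obtain ⟨p, q, -, rfl⟩ := hT.1
  exact isOpen_Ioo

lemma IsNiceInterval.isPreconnected {T : Set ℝ} (hT : IsNiceInterval f T) : IsPreconnected T := by
  obtain ⟨p, q, -, rfl⟩ := hT.1
  exact isPreconnected_Ioo

lemma exists_mem_frontier_of_not_subset {g : ℝ → ℝ} {S T : Set ℝ} (hT : IsOpenInterval T)
    (hS : IsPreconnected S) (hg : ContinuousOn g S) {x y : ℝ} (hx : x ∈ S) (hxT : g x ∈ T)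
    (hy : y ∈ S) (hyT : g y ∉ T) : ∃ w ∈ S, g w ∈ frontier T := by
  obtain ⟨p, q, hpq, rfl⟩ := hT
  rw [frontier_Ioo hpq]
  rcases le_or_gt (g y) p with h | h
  · obtain ⟨w, hw, hw'⟩ := hS.intermediate_value hy hx hg ⟨h, hxT.1.le⟩
    exact ⟨w, hw, Or.inl hw'⟩
  · have h' : q ≤ g y := not_lt.1 fun h' => hyT ⟨h, h'⟩
    obtain ⟨w, hw, hw'⟩ := hS.intermediate_value hx hy hg ⟨hxT.2.le, h'⟩
    exact ⟨w, hw, Or.inr hw'⟩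

lemma UnimodalA.isFirstReturnTime_of_image_subset (h : UnimodalA f c l) {T K : Set ℝ}
    (hT : IsNiceInterval f T) (hK : IsPreconnected K) (hKI : K ⊆ Icc 0 1) {x : ℝ} (hx : x ∈ K)
    {r : ℕ} (hr : IsFirstReturnTime f T x r) (hKT : ∀ z ∈ K, f^[r] z ∈ T) {z : ℝ} (hz : z ∈ K) :
    IsFirstReturnTime f T z r := by
  refine ⟨hr.1, hKT z hz, fun j hj hjr hzT => ?_⟩
  obtain ⟨w, hw, hw'⟩ := exists_mem_frontier_of_not_subset hT.1 hK
    ((h.continuousOn_iterate j).mono hKI) hz hzT hx (hr.2.2 j hj hjr)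
  apply hT.2.2.1 (r - j) _ hw'
  rw [iterate_sub_iterate hjr.le]
  exact hKT w hw

lemma UnimodalA.isFirstReturnTime_of_subset_entryDomain (h : UnimodalA f c l) {T S : Set ℝ}
    (hT : IsNiceInterval f T) (hS : IsPreconnected S) (hSI : S ⊆ Icc 0 1)
    (hSD : S ⊆ entryDomain f T) {x : ℝ} (hx : x ∈ S) {r : ℕ} (hr : IsFirstReturnTime f T x r)
    {z : ℝ} (hz : z ∈ S) : IsFirstReturnTime f T z r := by
  have hex : ∃ k, 1 ≤ k ∧ ∃ z ∈ S, f^[k] z ∈ T := by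
    obtain ⟨k, hk, hk'⟩ := hSD hx
    exact ⟨k, hk, x, hx, hk'⟩
  obtain ⟨k, ⟨hk, y, hy, hyT⟩, hmin⟩ : ∃ k, (1 ≤ k ∧ ∃ z ∈ S, f^[k] z ∈ T) ∧
      ∀ j < k, ¬(1 ≤ j ∧ ∃ z ∈ S, f^[j] z ∈ T) :=
    ⟨Nat.find hex, Nat.find_spec hex, fun j hj => Nat.find_min hex hj⟩
  have hall : ∀ z ∈ S, f^[k] z ∈ T := by
    intro z hz
    by_contra hzT
    obtain ⟨w, hw, hw'⟩ := exists_mem_frontier_of_not_subset hT.1 hS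
      ((h.continuousOn_iterate k).mono hSI) hy hyT hz hzT
    obtain ⟨n, hn, hn'⟩ := hSD hw
    have hkn : k ≤ n := not_lt.1 fun hnk => hmin n hnk ⟨hn, w, hw, hn'⟩
    apply hT.2.2.1 (n - k) _ hw'
    rwa [iterate_sub_iterate hkn]
  have hfirst : ∀ z ∈ S, IsFirstReturnTime f T z k := fun z hz =>
    ⟨hk, hall z hz, fun j hj hjk hjT => hmin j hjk ⟨hj, z, hz, hjT⟩⟩
  have : r = k := by
    rcases lt_trichotomy r k with h' | h' | h'
    · exact absurd hr.2.1 ((hfirst x hx).2.2 r hr.1 h')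
    · exact h'
    · exact absurd (hall x hx) (hr.2.2 k hk h')
  exact this ▸ hfirst z hz

lemma exists_isFirstReturnTime {T : Set ℝ} {x : ℝ} (hx : x ∈ entryDomain f T) :
    ∃ r, IsFirstReturnTime f T x r :=
  ⟨Nat.find hx, (Nat.find_spec hx).1, (Nat.find_spec hx).2, fun _ hj hjr hjT =>
    Nat.find_min hx hjr ⟨hj, hjT⟩⟩

end Iterates

namespace IsMaximalCentralCascade

variable {f : ℝ → ℝ} {c l : ℝ} {T : ℕ → Set ℝ} {m s : ℕ}

lemma nice (hT : IsMaximalCentralCascade f c T m s) {i : ℕ} (hi : i ≤ m) :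
    IsNiceInterval f (T i) := (hT.2.2.1 i hi).1

lemma c_mem (hT : IsMaximalCentralCascade f c T m s) {i : ℕ} (hi : i ≤ m) : c ∈ T i :=
  (hT.2.2.1 i hi).2.1

lemma subset_Icc (hT : IsMaximalCentralCascade f c T m s) {i : ℕ} (hi : i ≤ m) :
    T i ⊆ Icc 0 1 := (hT.nice hi).2.1

lemma succ_subset_inter (hT : IsMaximalCentralCascade f c T m s) {i : ℕ} (hi : i < m) :
    T (i + 1) ⊆ entryDomain f (T i) ∩ T i := by
  rw [hT.2.2.2.1 i hi]
  exact connectedComponentIn_subset _ _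

lemma subset_of_le (hT : IsMaximalCentralCascade f c T m s) {i j : ℕ} (hij : i ≤ j) (hj : j ≤ m) :
    T j ⊆ T i := by
  induction j, hij using Nat.le_induction with
  | base => exact Subset.rfl
  | succ j hij ih =>
    exact Subset.trans (fun x hx => (hT.succ_subset_inter (by omega) hx).2) (ih (by omega))

lemma subset_succ (hT : IsMaximalCentralCascade f c T m s) {i : ℕ} (hi : i < m) {S : Set ℝ}
    (hS : IsPreconnected S) (hc : c ∈ S) (hST : S ⊆ entryDomain f (T i) ∩ T i) :
    S ⊆ T (i + 1) := by
  rw [hT.2.2.2.1 i hi]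
  exact hS.subset_connectedComponentIn hc hST

lemma isFirstReturnTime (hT : IsMaximalCentralCascade f c T m s) (h : UnimodalA f c l) {i : ℕ}
    (hi : i < m) {z : ℝ} (hz : z ∈ T (i + 1)) : IsFirstReturnTime f (T i) z s :=
  h.isFirstReturnTime_of_subset_entryDomain (hT.nice hi.le) (hT.nice hi).isPreconnected
    (hT.subset_Icc hi) (fun _ hx => (hT.succ_subset_inter hi hx).1) (hT.c_mem hi)
    (hT.2.2.2.2.1 i hi) hz

lemma iterate_mem (hT : IsMaximalCentralCascade f c T m s) (h : UnimodalA f c l) {a : ℕ} :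
    ∀ t : ℕ, a + t ≤ m → ∀ z ∈ T (a + t), f^[t * s] z ∈ T a
  | 0, _, z, hz => by simpa using hz
  | t + 1, ht, z, hz => by
    rw [Nat.add_mul, one_mul, iterate_add_apply]
    exact hT.iterate_mem h t (by omega) _
      (hT.isFirstReturnTime h (i := a + t) (by omega) hz).2.1

lemma closure_subset_Icc (hT : IsMaximalCentralCascade f c T m s) {i : ℕ} (hi : i ≤ m) :
    closure (T i) ⊆ Icc 0 1 :=
  closure_minimal (hT.subset_Icc hi) isClosed_Icc

lemma notMem_of_mem_frontier (hT : IsMaximalCentralCascade f c T m s)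
    {i : ℕ} (hi : i < m) {z : ℝ} (hz : z ∈ frontier (T (i + 1))) : f^[s] z ∉ T i := by
  intro hzs
  have hzc : z ∈ closure (T (i + 1)) := frontier_subset_closure hz
  have hzn : z ∉ T (i + 1) := by
    rw [(hT.nice hi).isOpen.frontier_eq] at hz
    exact hz.2
  have hzi : z ∈ T i := by
    by_contra hzi
    refine (hT.nice hi.le).2.2.1 s z ?_ hzs
    rw [(hT.nice hi.le).isOpen.frontier_eq]
    exact ⟨closure_mono (hT.subset_of_le (Nat.le_succ i) hi) hzc, hzi⟩
  refine hzn (hT.subset_succ hi (S := insert z (T (i + 1))) ?_ (Or.inr (hT.c_mem hi)) ?_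
    (mem_insert z _))
  · exact (hT.nice hi).isPreconnected.subset_closure (subset_insert _ _)
      (insert_subset hzc subset_closure)
  · exact insert_subset ⟨⟨s, hT.2.1, hzs⟩, hzi⟩ (hT.succ_subset_inter hi)

lemma iterate_frontier_notMem (hT : IsMaximalCentralCascade f c T m s) (h : UnimodalA f c l) :
    ∀ t ≤ m, ∀ z ∈ frontier (T t), ∀ p, t * s ≤ p → f^[p] z ∉ T 0
  | 0, ht, z, hz, p, _ => (hT.nice ht).2.2.1 p z hz
  | t + 1, ht, z, hz, p, hp => by
    rw [Nat.add_mul, one_mul] at hp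
    have hzI := hT.closure_subset_Icc ht (frontier_subset_closure hz)
    have hfr : f^[s] z ∈ frontier (T t) := by
      rw [(hT.nice (by omega : t ≤ m)).isOpen.frontier_eq]
      refine ⟨?_, hT.notMem_of_mem_frontier ht hz⟩
      have hcw : ContinuousWithinAt f^[s] (T (t + 1)) z :=
        (h.continuousOn_iterate s z hzI).mono (hT.subset_Icc ht)
      exact hcw.mem_closure (frontier_subset_closure hz)
        fun w hw => (hT.isFirstReturnTime h ht hw).2.1
    have := hT.iterate_frontier_notMem h t (by omega) _ hfr (p - s) (by omega)
    rwa [iterate_sub_iterate (by omega)] at this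

lemma mem_succ_of_iterate_mem (hT : IsMaximalCentralCascade f c T m s) (h : UnimodalA f c l)
    {a : ℕ} (ha : a + 1 < m) {z : ℝ} (hz : z ∈ T (a + 1)) (hzs : f^[s] z ∈ T (a + 1)) :
    z ∈ T (a + 2) := by
  have hc := hT.c_mem (by omega : a + 1 ≤ m)
  have hconn := (hT.nice (by omega : a + 1 ≤ m)).isPreconnected.ordConnected
  have hsub : uIcc c z ⊆ T (a + 1) := hconn.uIcc_subset hc hz
  have hI : uIcc c z ⊆ Icc 0 1 := hsub.trans (hT.subset_Icc (by omega))
  have hinj : InjOn f^[s] (uIcc c z) := by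
    refine h.injOn_iterate hI s fun j hj => ?_
    rintro ⟨w, hw, hwc⟩
    rcases Nat.eq_zero_or_pos j with rfl | hj0
    · have hwc : w = c := hwc
      subst hwc
      rcases le_total w z with hle | hle
      · rw [inf_eq_left.2 hle] at hw; exact lt_irrefl _ hw.1
      · rw [sup_eq_left.2 hle] at hw; exact lt_irrefl _ hw.2
    · have := (hT.isFirstReturnTime h (by omega) (hsub (Ioo_subset_Icc_self hw))).2.2 j hj0 hj
      rw [hwc] at this
      exact this (hT.c_mem (by omega))
  have hcs : f^[s] c ∈ T (a + 1) := (hT.2.2.2.2.1 (a + 1) ha).2.1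
  have him : ∀ w ∈ uIcc c z, f^[s] w ∈ T (a + 1) := by
    intro w hw
    refine (hconn.uIcc_subset hcs hzs) ?_
    have hmm : c ⊓ z ≤ c ⊔ z := inf_le_sup
    rcases h.strictMonoOn_or_strictAntiOn hmm hI hinj with hm | hm
    · exact hm.monotoneOn.mapsTo_uIcc hw
    · exact hm.antitoneOn.mapsTo_uIcc hw
  exact hT.subset_succ ha isPreconnected_uIcc left_mem_uIcc
    (fun w hw => ⟨⟨s, hT.2.1, him w hw⟩, hsub hw⟩) right_mem_uIcc

lemma iterate_mem_diff (hT : IsMaximalCentralCascade f c T m s) (h : UnimodalA f c l) {a : ℕ} :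
    ∀ t : ℕ, a + t < m → ∀ z ∈ T (a + t), z ∉ T (a + t + 1) →
      f^[t * s] z ∈ T a ∧ f^[t * s] z ∉ T (a + 1)
  | 0, _, z, hz, hz' => by simpa using ⟨hz, hz'⟩
  | t + 1, ht, z, hz, hz' => by
    rw [Nat.add_mul, one_mul, iterate_add_apply]
    refine hT.iterate_mem_diff h t (by omega) _
      (hT.isFirstReturnTime h (i := a + t) (by omega) hz).2.1 ?_
    exact fun hzs => hz' (hT.mem_succ_of_iterate_mem h (a := a + t) (by omega) hz hzs)

lemma exists_mem_diff (T : ℕ → Set ℝ) {y : ℝ} {t n : ℕ} (htn : t ≤ n) (hy : y ∈ T t)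
    (hy' : y ∉ T (n + 1)) : ∃ a, t ≤ a ∧ a ≤ n ∧ y ∈ T a ∧ y ∉ T (a + 1) := by
  induction n, htn using Nat.le_induction with
  | base => exact ⟨t, le_rfl, le_rfl, hy, hy'⟩
  | succ n htn ih =>
    by_cases hyn : y ∈ T (n + 1)
    · exact ⟨n + 1, by omega, le_rfl, hyn, hy'⟩
    · obtain ⟨a, h1, h2, h3⟩ := ih hyn
      exact ⟨a, h1, by omega, h3⟩

lemma c_notMem_image (hT : IsMaximalCentralCascade f c T m s) (h : UnimodalA f c l) {i : ℕ}
    (hi : 1 ≤ i) (him : i < m) {x : ℝ} (hx : x ∉ T (i + 1)) {r : ℕ}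
    (hr : IsFirstReturnTime f (T i) x r) {M : Set ℝ} (hM : IsPreconnected M)
    (hMI : M ⊆ Icc 0 1) (hxM : x ∈ M) (hMT : ∀ z ∈ M, f^[r] z ∈ T 0) {j : ℕ} (hj : j < r) :
    c ∉ f^[j] '' M := by
  rintro ⟨w, hw, hwc⟩
  set p := r - j with hp
  set t := min (p / s) m with ht
  have hs : 1 ≤ s := hT.2.1
  have htm : t ≤ m := min_le_right _ _
  have htp : t * s ≤ p := (Nat.mul_le_mul_right s (min_le_left _ _)).trans (Nat.div_mul_le_self p s)
  have hxt : f^[j] x ∈ T t := by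
    by_contra hxt
    obtain ⟨w', hw', hw''⟩ := exists_mem_frontier_of_not_subset (hT.nice htm).1 hM
      ((h.continuousOn_iterate j).mono hMI) hw (hwc ▸ hT.c_mem htm) hxM hxt
    apply hT.iterate_frontier_notMem h t htm _ hw'' p htp
    rw [hp, iterate_sub_iterate hj.le]
    exact hMT w' hw'
  have hxi : f^[j] x ∉ T (i + 1) := by
    rcases Nat.eq_zero_or_pos j with rfl | hj0
    · exact hx
    · exact fun hxj => hr.2.2 j hj0 hj (hT.subset_of_le (Nat.le_succ i) him hxj)
  have hti : t ≤ i := by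
    by_contra! hti
    exact hxi (hT.subset_of_le hti htm hxt)
  have htps : t = p / s := by
    rcases min_choice (p / s) m with h' | h' <;> omega
  have hpdiv : p = p % s + t * s := by
    rw [htps, mul_comm]; exact (Nat.mod_add_div p s).symm
  have hcp : f^[p] c ∈ T 0 := by
    rw [← hwc, hp, iterate_sub_iterate hj.le]
    exact hMT w hw
  have hct : f^[t * s] c ∈ T 1 := hT.iterate_mem h t (by omega) c (hT.c_mem (by omega))
  have hu : p % s = 0 := by
    by_contra hu
    rw [hpdiv, iterate_add_apply] at hcp
    exact (hT.isFirstReturnTime h (by omega) hct).2.2 (p % s) (by omega)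
      (Nat.mod_lt p hs) hcp
  have hpt : t * s = p := by omega
  have ht1 : 1 ≤ t := by
    rcases Nat.eq_zero_or_pos t with h' | h'
    · rw [h'] at hpt; omega
    · exact h'
  obtain ⟨a, hta, hai, hya, hya'⟩ := exists_mem_diff T hti hxt hxi
  obtain ⟨e, rfl⟩ : ∃ e, a = e + t := ⟨a - t, by omega⟩
  have := (hT.iterate_mem_diff h t (by omega) _ hya hya').2
  rw [hpt, hp, iterate_sub_iterate hj.le] at this
  exact this (hT.subset_of_le (by omega) him.le hr.2.1)

end IsMaximalCentralCascade

section Koebe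

variable {f : ℝ → ℝ} {c l C : ℝ}

lemma exists_left_endpoint {g : ℝ → ℝ} {T : Set ℝ} (hT : IsOpen T) {y b : ℝ} (hyb : y ≤ b)
    (hg : ContinuousOn g (Icc y b)) (hy : g y ∉ T) (hb : g b ∈ T) :
    ∃ a, y ≤ a ∧ a < b ∧ g a ∉ T ∧ ∀ z ∈ Ioc a b, g z ∈ T := by
  have hcl : IsClosed (Icc y b ∩ g ⁻¹' Tᶜ) :=
    hg.preimage_isClosed_of_isClosed isClosed_Icc hT.isClosed_compl
  have hcp : IsCompact (Icc y b ∩ g ⁻¹' Tᶜ) :=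
    isCompact_Icc.of_isClosed_subset hcl inter_subset_left
  obtain ⟨a, ⟨⟨h1, h2⟩, h3⟩, ha⟩ := hcp.exists_isGreatest ⟨y, ⟨le_rfl, hyb⟩, hy⟩
  refine ⟨a, h1, lt_of_le_of_ne h2 fun hab => h3 (hab ▸ hb), h3, fun z hz => ?_⟩
  by_contra hzT
  exact absurd (ha ⟨⟨h1.trans hz.1.le, hz.2⟩, hzT⟩) (not_le.2 hz.1)

lemma exists_right_endpoint {g : ℝ → ℝ} {T : Set ℝ} (hT : IsOpen T) {y b : ℝ} (hyb : b ≤ y)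
    (hg : ContinuousOn g (Icc b y)) (hy : g y ∉ T) (hb : g b ∈ T) :
    ∃ a, b < a ∧ a ≤ y ∧ g a ∉ T ∧ ∀ z ∈ Ico b a, g z ∈ T := by
  have hcl : IsClosed (Icc b y ∩ g ⁻¹' Tᶜ) :=
    hg.preimage_isClosed_of_isClosed isClosed_Icc hT.isClosed_compl
  have hcp : IsCompact (Icc b y ∩ g ⁻¹' Tᶜ) :=
    isCompact_Icc.of_isClosed_subset hcl inter_subset_left
  obtain ⟨a, ⟨⟨h1, h2⟩, h3⟩, ha⟩ := hcp.exists_isLeast ⟨y, ⟨hyb, le_rfl⟩, hy⟩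
  refine ⟨a, lt_of_le_of_ne h1 fun hab => h3 (hab ▸ hb), h2, h3, fun z hz => ?_⟩
  by_contra hzT
  exact absurd (ha ⟨⟨hz.1, hz.2.le.trans h2⟩, hzT⟩) (not_le.2 hz.2)

lemma UnimodalA.crossLog_le_iterate (h : UnimodalA f c l) (hC : OneStepCrossBound f c C)
    {a b b' d : ℝ} (hab : a < b) (hbb : b ≤ b') (hbd : b' < d) (hI : Icc a d ⊆ Icc 0 1) :
    ∀ n : ℕ, (∀ j < n, c ∉ f^[j] '' Ioo a d) →
      crossLog a b b' d ≤ crossLog (f^[n] a) (f^[n] b) (f^[n] b') (f^[n] d) +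
        C * ∑ j ∈ Finset.range n, |f^[j] d - f^[j] a| * |f^[j] b' - f^[j] b|
  | 0, _ => by simp
  | n + 1, hn => by
    have hn' : ∀ j < n, c ∉ f^[j] '' Ioo a d := fun j hj => hn j (hj.trans (Nat.lt_succ_self n))
    have ih := UnimodalA.crossLog_le_iterate h hC hab hbb hbd hI n hn'
    have ma : a ∈ Icc a d := ⟨le_rfl, by linarith⟩
    have mb : b ∈ Icc a d := ⟨by linarith, by linarith⟩
    have mb' : b' ∈ Icc a d := ⟨by linarith, by linarith⟩
    have md : d ∈ Icc a d := ⟨by linarith, le_rfl⟩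
    have hinj := h.injOn_iterate hI n hn'
    have hcn : c ∉ f^[n] '' Ioo a d := hn n (Nat.lt_succ_self n)
    have hcd : c ∉ Ioo (min (f^[n] a) (f^[n] d)) (max (f^[n] a) (f^[n] d)) := by
      intro hcm
      rcases le_or_ge_of_notMem_image_Ioo ((h.continuousOn_iterate n).mono hI) hcn with h' | h'
      · exact absurd hcm.2 (not_lt.2 (max_le (h' a ma) (h' d md)))
      · exact absurd hcm.1 (not_lt.2 (le_min (h' a ma) (h' d md)))
    have hord : (f^[n] a < f^[n] b ∧ f^[n] b ≤ f^[n] b' ∧ f^[n] b' < f^[n] d) ∨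
        (f^[n] d < f^[n] b' ∧ f^[n] b' ≤ f^[n] b ∧ f^[n] b < f^[n] a) := by
      rcases h.strictMonoOn_or_strictAntiOn (by linarith) hI hinj with hm | hm
      · exact Or.inl ⟨hm ma mb hab, hm.monotoneOn mb mb' hbb, hm mb' md hbd⟩
      · exact Or.inr ⟨hm mb' md hbd, hm.antitoneOn mb mb' hbb, hm ma mb hab⟩
    have := hC _ (h.iterate_mem n (hI ma)) _ (h.iterate_mem n (hI mb)) _
      (h.iterate_mem n (hI mb')) _ (h.iterate_mem n (hI md)) hord hcd
    rw [Finset.sum_range_succ, mul_add]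
    simp only [iterate_succ_apply']
    linarith

lemma UnimodalA.sum_abs_iterate_sub_le_one (h : UnimodalA f c l) {T : Set ℝ} {b b' : ℝ}
    (hbb : b ≤ b') (hI : Icc b b' ⊆ Icc 0 1) {r : ℕ}
    (hr : ∀ z ∈ Icc b b', IsFirstReturnTime f T z r) :
    ∑ j ∈ Finset.range r, |f^[j] b' - f^[j] b| ≤ 1 := by
  have hsub : ∀ j, uIoc (f^[j] b) (f^[j] b') ⊆ f^[j] '' Icc b b' := by
    intro j
    have := intermediate_value_uIcc (f := f^[j]) (a := b) (b := b')
      (by rw [uIcc_of_le hbb]; exact (h.continuousOn_iterate j).mono hI)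
    rw [uIcc_of_le hbb] at this
    exact uIoc_subset_uIcc.trans this
  have hlt : ∀ j k, j < k → k < r →
      Disjoint (uIoc (f^[j] b) (f^[j] b')) (uIoc (f^[k] b) (f^[k] b')) := by
    intro j k hjk hk
    rw [disjoint_left]
    intro w hw hw'
    obtain ⟨z, hz, rfl⟩ := hsub j hw
    obtain ⟨z', hz', hzz⟩ := hsub k hw'
    have h1 := (hr z' hz').2.1
    rw [← iterate_sub_iterate hk.le, hzz, ← iterate_add_apply] at h1
    exact (hr z hz).2.2 (r - k + j) (by omega) (by omega) h1
  have hdis : (Finset.range r : Set ℕ).PairwiseDisjoint fun j => uIoc (f^[j] b) (f^[j] b') := by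
    intro j hj k hk hjk
    rw [Finset.mem_coe, Finset.mem_range] at hj hk
    rcases lt_or_gt_of_ne hjk with h' | h'
    · exact hlt j k h' hk
    · exact (hlt k j h' hj).symm
  have hvol : ∀ j, volume (uIoc (f^[j] b) (f^[j] b')) = ENNReal.ofReal |f^[j] b' - f^[j] b| := by
    intro j
    rw [Real.volume_uIoc]
  have hmeas := measure_biUnion_finset (μ := volume) hdis fun j _ => measurableSet_uIoc
  have hle : volume (⋃ j ∈ Finset.range r, uIoc (f^[j] b) (f^[j] b')) ≤
      volume (Icc (0:ℝ) 1) := by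
    refine measure_mono (iUnion₂_subset fun j _ => (hsub j).trans ?_)
    rintro _ ⟨z, hz, rfl⟩
    exact h.iterate_mem j (hI hz)
  rw [hmeas] at hle
  simp only [hvol, Real.volume_Icc, sub_zero] at hle
  rw [← ENNReal.ofReal_sum_of_nonneg fun j _ => abs_nonneg _] at hle
  exact (ENNReal.ofReal_le_ofReal_iff zero_le_one).1 hle

lemma crossLog_le_of_wellInside {P Q α β B B' τ : ℝ} (hτ : 0 < τ)
    (h1 : τ * (β - α) ≤ α - P) (h2 : τ * (β - α) ≤ Q - β) (hB : α < B) (hBB : B ≤ B')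
    (hB' : B' < β) : crossLog P B B' Q ≤ 2 * Real.log (1 + 1 / τ) := by
  have key : ∀ u v : ℝ, 0 < u → τ * v ≤ u → 0 ≤ v →
      Real.log (u + v) - Real.log u ≤ Real.log (1 + 1 / τ) := by
    intro u v hu huv hv
    rw [← Real.log_div (by linarith) hu.ne']
    refine Real.log_le_log (by positivity) ?_
    rw [add_div, div_self hu.ne']
    have : v / u ≤ 1 / τ := by
      rw [div_le_div_iff₀ hu hτ]
      linarith
    linarith
  have hpos : 0 ≤ τ * (β - α) := mul_nonneg hτ.le (by linarith)
  have hv : τ * (B' - B) ≤ τ * (β - α) := mul_le_mul_of_nonneg_left (by linarith) hτ.le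
  have k1 := key (B - P) (B' - B) (by linarith) (by linarith) (by linarith)
  have k2 := key (Q - B') (B' - B) (by linarith) (by linarith) (by linarith)
  unfold crossLog
  rw [show B - P + (B' - B) = B' - P by ring] at k1
  rw [show Q - B' + (B' - B) = Q - B by ring] at k2
  linarith

lemma sub_le_exp_mul_of_crossLog_le {a b b' d K : ℝ} (hab : a < b) (hbb : b ≤ b') (hbd : b' < d)
    (hK : crossLog a b b' d ≤ K) :
    b' - b ≤ Real.exp K * (b - a) ∧ b' - b ≤ Real.exp K * (d - b') := by
  unfold crossLog at hK
  have l1 : Real.log (d - b') ≤ Real.log (d - b) := Real.log_le_log (by linarith) (by linarith)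
  have l2 : Real.log (b - a) ≤ Real.log (b' - a) := Real.log_le_log (by linarith) (by linarith)
  have key : ∀ u v : ℝ, 0 < u → 0 < v → Real.log v ≤ K + Real.log u → v ≤ Real.exp K * u := by
    intro u v hu hv huv
    rw [← Real.exp_log hu, ← Real.exp_add, ← Real.log_le_iff_le_exp hv]
    exact huv
  constructor
  · have := key (b - a) (b' - a) (by linarith) (by linarith) (by linarith)
    linarith
  · have := key (d - b') (d - b) (by linarith) (by linarith) (by linarith)
    linarith

lemma IsMaximalCentralCascade.exists_koebe_space {T : ℕ → Set ℝ} {m s : ℕ}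
    (hT : IsMaximalCentralCascade f c T m s) (h : UnimodalA f c l) (hC0 : 0 ≤ C)
    (hC : OneStepCrossBound f c C) {τ : ℝ} (hτ : 0 < τ) (hw : WellInside τ (T 1) (T 0))
    {i : ℕ} (hi : 1 ≤ i) (him : i < m) {b b' y y' x : ℝ} (hyb : y ≤ b) (hbb : b < b')
    (hby : b' ≤ y') (hI : Icc y y' ⊆ Icc 0 1) (hx : x ∈ Icc b b') (hxi : x ∉ T (i + 1)) {r : ℕ}
    (hr : IsFirstReturnTime f (T i) x r) (hbT : ∀ z ∈ Icc b b', f^[r] z ∈ T i)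
    (hy : f^[r] y ∉ T 0) (hy' : f^[r] y' ∉ T 0) :
    ∃ a d, y ≤ a ∧ a < b ∧ b' < d ∧ d ≤ y' ∧ (∀ j ≤ r, InjOn f^[j] (Icc a d)) ∧
      (∀ z ∈ Ioo a d, f^[r] z ∈ T 0) ∧
      ∀ η, (∀ j < r, |f^[j] d - f^[j] a| ≤ η) →
        b' - b ≤ Real.exp (2 * Real.log (1 + 1 / τ) + C * η) * (b - a) ∧
        b' - b ≤ Real.exp (2 * Real.log (1 + 1 / τ) + C * η) * (d - b') := by
  have hi0 : T i ⊆ T 0 := hT.subset_of_le (by omega) him.le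
  have hop := (hT.nice (Nat.zero_le m)).isOpen
  have hcont := h.continuousOn_iterate r
  obtain ⟨a, hya, hab, haT, haz⟩ := exists_left_endpoint (g := f^[r]) hop hyb
    (hcont.mono ((Icc_subset_Icc le_rfl (by linarith)).trans hI)) hy
    (hi0 (hbT b ⟨le_rfl, hbb.le⟩))
  obtain ⟨d, hbd, hdy, hdT, hdz⟩ := exists_right_endpoint (g := f^[r]) hop hby
    (hcont.mono ((Icc_subset_Icc (by linarith) le_rfl).trans hI)) hy'
    (hi0 (hbT b' ⟨hbb.le, le_rfl⟩))
  have hadI : Icc a d ⊆ Icc 0 1 := (Icc_subset_Icc hya hdy).trans hI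
  have hbI : Icc b b' ⊆ Icc 0 1 := (Icc_subset_Icc hyb hby).trans hI
  have hM : ∀ z ∈ Ioo a d, f^[r] z ∈ T 0 := by
    intro z hz
    rcases le_or_gt z b with h1 | h1
    · exact haz z ⟨hz.1, h1⟩
    rcases le_or_gt z b' with h2 | h2
    · exact hi0 (hbT z ⟨h1.le, h2⟩)
    · exact hdz z ⟨h2.le, hz.2⟩
  have hcM : ∀ j < r, c ∉ f^[j] '' Ioo a d := fun j hj =>
    hT.c_notMem_image h hi him hxi hr isPreconnected_Ioo (Ioo_subset_Icc_self.trans hadI)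
      ⟨by linarith [hx.1], by linarith [hx.2]⟩ hM hj
  have hinj : ∀ j ≤ r, InjOn f^[j] (Icc a d) := fun j hj =>
    h.injOn_iterate hadI j fun k hk => hcM k (by omega)
  refine ⟨a, d, hya, hab, hbd, hdy, hinj, hM, fun η hη => ?_⟩
  refine sub_le_exp_mul_of_crossLog_le hab hbb.le hbd ?_
  have hfirst : ∀ z ∈ Icc b b', IsFirstReturnTime f (T i) z r := fun z hz =>
    h.isFirstReturnTime_of_image_subset (hT.nice him.le) isPreconnected_Icc hbI hx hr hbT hz
  have hsum : ∑ j ∈ Finset.range r, |f^[j] d - f^[j] a| * |f^[j] b' - f^[j] b| ≤ η := by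
    have hη0 : 0 ≤ η := (abs_nonneg _).trans (hη 0 hr.1)
    calc _ ≤ ∑ j ∈ Finset.range r, η * |f^[j] b' - f^[j] b| :=
          Finset.sum_le_sum fun j hj =>
            mul_le_mul_of_nonneg_right (hη j (Finset.mem_range.1 hj)) (abs_nonneg _)
      _ = η * ∑ j ∈ Finset.range r, |f^[j] b' - f^[j] b| := by rw [Finset.mul_sum]
      _ ≤ η * 1 := mul_le_mul_of_nonneg_left (h.sum_abs_iterate_sub_le_one hbb.le hbI hfirst) hη0
      _ = η := mul_one η
  have hcross := h.crossLog_le_iterate hC hab hbb.le hbd hadI r hcM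
  have hend : crossLog (f^[r] a) (f^[r] b) (f^[r] b') (f^[r] d) ≤ 2 * Real.log (1 + 1 / τ) := by
    obtain ⟨α, β, P, Q, hPα, hαβ, hβQ, hT1, hT0, e1, e2⟩ := hw
    have hi1 : T i ⊆ T 1 := hT.subset_of_le hi him.le
    have hB := hi1 (hbT b ⟨le_rfl, hbb.le⟩)
    have hB' := hi1 (hbT b' ⟨hbb.le, le_rfl⟩)
    rw [hT1] at hB hB'
    have ma : a ∈ Icc a d := ⟨le_rfl, by linarith⟩
    have mb : b ∈ Icc a d := ⟨by linarith, by linarith⟩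
    have mb' : b' ∈ Icc a d := ⟨by linarith, by linarith⟩
    have md : d ∈ Icc a d := ⟨by linarith, le_rfl⟩
    have hout : ∀ {u v : ℝ}, u ∉ T 0 → v ∈ Ioo α β → (u < v → u ≤ P) ∧ (v < u → Q ≤ u) := by
      intro u v hu hv
      rw [hT0] at hu
      exact ⟨fun huv => not_lt.1 fun hPu => hu ⟨hPu, by linarith [hv.2]⟩,
        fun hvu => not_lt.1 fun huQ => hu ⟨by linarith [hv.1], huQ⟩⟩
    rcases h.strictMonoOn_or_strictAntiOn (by linarith) hadI (hinj r le_rfl) with hm | hm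
    · have u1 := (hout haT hB).1 (hm ma mb hab)
      have u2 := (hout hdT hB').2 (hm mb' md hbd)
      exact crossLog_le_of_wellInside hτ (by linarith) (by linarith) hB.1
        (hm mb mb' hbb).le hB'.2
    · have u1 := (hout haT hB).2 (hm ma mb hab)
      have u2 := (hout hdT hB').1 (hm mb' md hbd)
      rw [← crossLog_rev]
      exact crossLog_le_of_wellInside hτ (by linarith) (by linarith) hB'.1
        (hm mb mb' hbb).le hB.2
  have := mul_le_mul_of_nonneg_left hsum hC0
  linarith

end Koebe

section Contraction

variable {f : ℝ → ℝ} {c l C τ : ℝ}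

/-- A maximal central cascade with at least two steps, whose largest interval is shorter than `δ`
and contains the next one `τ`-well inside. -/
def IsSmallCascade (f : ℝ → ℝ) (c τ δ : ℝ) (T : ℕ → Set ℝ) (m s : ℕ) : Prop :=
  IsMaximalCentralCascade f c T m s ∧ 2 ≤ m ∧ len (T 0) < δ ∧ WellInside τ (T 1) (T 0)

/-- The interval `[u, v]` is mapped injectively by iterates of `f` into arbitrarily small
cascades. -/
def EntersSmallCascades (f : ℝ → ℝ) (c τ u v : ℝ) : Prop :=
  ∀ δ > 0, ∃ T m s, IsSmallCascade f c τ δ T m s ∧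
    ∃ q, InjOn f^[q] (Icc u v) ∧ MapsTo f^[q] (Icc u v) (T 0)

lemma IsSmallCascade.mono {T : ℕ → Set ℝ} {m s : ℕ} {δ δ' : ℝ}
    (hT : IsSmallCascade f c τ δ T m s) (hδ : δ ≤ δ') : IsSmallCascade f c τ δ' T m s :=
  ⟨hT.1, hT.2.1, hT.2.2.1.trans_le hδ, hT.2.2.2⟩

lemma IsOpenInterval.abs_sub_lt_len {T : Set ℝ} (hT : IsOpenInterval T) {x y : ℝ} (hx : x ∈ T)
    (hy : y ∈ T) : |x - y| < len T := by
  obtain ⟨p, q, hpq, rfl⟩ := hT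
  rw [len, Real.volume_Ioo, ENNReal.toReal_ofReal (by linarith), abs_lt]
  constructor <;> linarith [hx.1, hx.2, hy.1, hy.2]

lemma IsSmallCascade.abs_sub_lt {T : ℕ → Set ℝ} {m s : ℕ} {δ x y : ℝ}
    (hT : IsSmallCascade f c τ δ T m s) (hx : x ∈ T 0) (hy : y ∈ T 0) : |x - y| < δ :=
  ((hT.1.nice (Nat.zero_le m)).1.abs_sub_lt_len hx hy).trans hT.2.2.1

/-- Sufficiently small cascades lie in any given neighbourhood of `c`. -/
lemma exists_forall_isSmallCascade_subset {U : Set ℝ} (hU : IsOpen U) (hc : c ∈ U) :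
    ∃ δ > 0, ∀ T m s, IsSmallCascade f c τ δ T m s → T 0 ⊆ U := by
  obtain ⟨δ, hδ, hU'⟩ := Metric.isOpen_iff.1 hU c hc
  exact ⟨δ, hδ, fun T m s hT x hx => hU' (by
    rw [Metric.mem_ball, Real.dist_eq]
    exact hT.abs_sub_lt hx (hT.1.c_mem (Nat.zero_le m)))⟩

lemma injOn_iterate_of_le {S : Set ℝ} {p q : ℕ} (hpq : p ≤ q) (hq : InjOn f^[q] S) :
    InjOn f^[p] S := by
  intro x hx y hy hxy
  refine hq hx hy ?_
  rw [← iterate_sub_iterate hpq x, hxy, iterate_sub_iterate hpq y]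

namespace EntersSmallCascades

variable {u v : ℝ}

lemma exists_forall_le (huv : u ≤ v) : ∀ Q : ℕ, (∀ j < Q, f^[j] u ≠ f^[j] v) →
    ∃ δ > 0, ∀ T m s, IsSmallCascade f c τ δ T m s → ∀ q, MapsTo f^[q] (Icc u v) (T 0) → Q ≤ q
  | 0, _ => ⟨1, one_pos, fun _ _ _ _ q _ => Nat.zero_le q⟩
  | Q + 1, hQ => by
    obtain ⟨δ, hδ, hδ'⟩ := exists_forall_le huv Q fun j hj => hQ j (by omega)
    refine ⟨min δ |f^[Q] u - f^[Q] v|, lt_min hδ (abs_pos.2 (sub_ne_zero.2 (hQ Q (by omega)))),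
      fun T m s hT q hq => ?_⟩
    refine Nat.lt_of_le_of_ne (hδ' T m s (hT.mono (min_le_left _ _)) q hq) ?_
    rintro rfl
    have h1 := hT.abs_sub_lt (hq ⟨le_rfl, huv⟩) (hq ⟨huv, le_rfl⟩)
    exact absurd h1 (not_lt.2 (min_le_right _ _))

lemma injOn (hP : EntersSmallCascades f c τ u v) (huv : u < v) (Q : ℕ) :
    InjOn f^[Q] (Icc u v) := by
  induction Q using Nat.strong_induction_on with
  | _ Q ih =>
    obtain ⟨δ, hδ, hδ'⟩ := exists_forall_le (c := c) (τ := τ) huv.le Q fun j hj hjuv =>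
      huv.ne (ih j hj ⟨le_rfl, huv.le⟩ ⟨huv.le, le_rfl⟩ hjuv)
    obtain ⟨T, m, s, hT, q, hq, hqT⟩ := hP δ hδ
    exact injOn_iterate_of_le (hδ' T m s hT q hqT) hq

lemma exists_ge (hP : EntersSmallCascades f c τ u v) (huv : u < v) (Q : ℕ) {δ : ℝ} (hδ : 0 < δ) :
    ∃ T m s, IsSmallCascade f c τ δ T m s ∧ ∃ q, Q ≤ q ∧ MapsTo f^[q] (Icc u v) (T 0) := by
  obtain ⟨δ', hδ', h'⟩ := exists_forall_le (f := f) (c := c) (τ := τ) huv.le Q fun j _ hjuv =>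
    huv.ne (hP.injOn huv j ⟨le_rfl, huv.le⟩ ⟨huv.le, le_rfl⟩ hjuv)
  obtain ⟨T, m, s, hT, q, -, hqT⟩ := hP (min δ δ') (lt_min hδ hδ')
  exact ⟨T, m, s, hT.mono (min_le_left _ _), q, h' T m s (hT.mono (min_le_right _ _)) q hqT, hqT⟩

/-- Some iterate of `[u, v]` lies in a cascade and still enters arbitrarily small cascades. -/
lemma exists_image (hP : EntersSmallCascades f c τ u v) (h : UnimodalA f c l) (huv : u < v)
    (hI : Icc u v ⊆ Icc 0 1) : ∃ T m s u' v', IsSmallCascade f c τ 1 T m s ∧ u' < v' ∧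
      Icc u' v' ⊆ T 0 ∧ EntersSmallCascades f c τ u' v' := by
  obtain ⟨T, m, s, hT, q, hq, hqT⟩ := hP 1 one_pos
  have hcont := (h.continuousOn_iterate q).mono hI
  have key : ∃ u' v', u' < v' ∧ f^[q] '' Icc u v = Icc u' v' := by
    rcases h.strictMonoOn_or_strictAntiOn huv.le hI hq with hm | hm
    · refine ⟨f^[q] u, f^[q] v, hm ⟨le_rfl, huv.le⟩ ⟨huv.le, le_rfl⟩ huv, ?_⟩
      exact hm.monotoneOn.image_Icc_subset.antisymm (intermediate_value_Icc huv.le hcont)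
    · refine ⟨f^[q] v, f^[q] u, hm ⟨le_rfl, huv.le⟩ ⟨huv.le, le_rfl⟩ huv, ?_⟩
      exact hm.antitoneOn.image_Icc_subset.antisymm (intermediate_value_Icc' huv.le hcont)
  obtain ⟨u', v', huv', him⟩ := key
  refine ⟨T, m, s, u', v', hT, huv', him ▸ hqT.image_subset, fun δ hδ => ?_⟩
  obtain ⟨T', m', s', hT', q', hqq, hmaps⟩ := hP.exists_ge huv q hδ
  refine ⟨T', m', s', hT', q' - q, ?_, ?_⟩
  · rw [← him]
    rintro _ ⟨x, hx, rfl⟩ _ ⟨y, hy, rfl⟩ hxy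
    rw [iterate_sub_iterate hqq, iterate_sub_iterate hqq] at hxy
    rw [hP.injOn huv q' hx hy hxy]
  · rw [← him]
    rintro _ ⟨x, hx, rfl⟩
    rw [iterate_sub_iterate hqq]
    exact hmaps hx

/-- An interval entering small cascades can be enlarged by a definite factor. -/
lemma extend (hP : EntersSmallCascades f c τ u v) (h : UnimodalA f c l) (hC0 : 0 ≤ C)
    (hC : OneStepCrossBound f c C) (hτ : 0 < τ) (huv : u < v) {y y' : ℝ}
    (hB : IsNiceInterval f (Ioo y y')) (hcB : c ∈ Ioo y y') (hyu : y < u) (hvy : v < y')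
    {κ : ℝ} (hκ : κ = 1 / (2 * Real.exp (2 * Real.log (1 + 1 / τ) + C * 1))) :
    y < u - κ * (v - u) ∧ v + κ * (v - u) < y' ∧
      EntersSmallCascades f c τ (u - κ * (v - u)) (v + κ * (v - u)) := by
  have hyy : y < y' := by linarith
  have hfr : frontier (Ioo y y') = {y, y'} := frontier_Ioo hyy
  have hyI : Icc y y' ⊆ Icc 0 1 := by
    rw [← closure_Ioo hyy.ne]
    exact closure_minimal hB.2.1 isClosed_Icc
  obtain ⟨δB, hδB, hsubB⟩ := exists_forall_isSmallCascade_subset (f := f) (τ := τ) isOpen_Ioo hcB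
  have hE : 0 < Real.exp (2 * Real.log (1 + 1 / τ) + C * 1) := Real.exp_pos _
  have key : ∀ δ > 0, ∃ T m s, IsSmallCascade f c τ δ T m s ∧
      ∃ q a d, y ≤ a ∧ a < u - κ * (v - u) ∧ v + κ * (v - u) < d ∧ d ≤ y' ∧
        InjOn f^[q] (Icc a d) ∧ MapsTo f^[q] (Ioo a d) (T 0) := by
    intro δ hδ
    obtain ⟨T, m, s, hT', -⟩ := hP (min (min δ δB) (v - u))
      (lt_min (lt_min hδ hδB) (sub_pos.2 huv))
    have hT := hT'.1
    have hm := hT'.2.1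
    have hTB := hsubB T m s (hT'.mono ((min_le_left _ _).trans (min_le_right _ _)))
    have hT1 := hT.nice (by omega : 1 ≤ m)
    obtain ⟨δ1, hδ1, hsub1⟩ := exists_forall_isSmallCascade_subset (f := f) (τ := τ) hT1.isOpen
      (hT.c_mem (by omega))
    obtain ⟨T₂, m₂, s₂, hT₂, q, hq, hqT⟩ := hP.exists_ge huv 1 hδ1
    have hent : Icc u v ⊆ entryDomain f (T 1) := fun z hz =>
      ⟨q, hq, hsub1 T₂ m₂ s₂ hT₂ (hqT hz)⟩
    obtain ⟨x, hx, hx0⟩ : ∃ x ∈ Icc u v, x ∉ T 0 := by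
      by_contra! hcon
      have := hT'.abs_sub_lt (hcon v ⟨huv.le, le_rfl⟩) (hcon u ⟨le_rfl, huv.le⟩)
      rw [abs_of_pos (sub_pos.2 huv)] at this
      exact absurd this (not_lt.2 (min_le_right _ _))
    obtain ⟨r, hr⟩ := exists_isFirstReturnTime (hent hx)
    have huI : Icc u v ⊆ Icc 0 1 := (Icc_subset_Icc hyu.le hvy.le).trans hyI
    obtain ⟨a, d, h1, h2, h3, h4, h5, h6, h7⟩ := hT.exists_koebe_space h hC0 hC hτ hT'.2.2.2
      le_rfl (by omega : 1 < m) hyu.le huv hvy.le hyI hx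
      (fun hx2 => hx0 (hT.subset_of_le (by omega) (by omega) hx2)) hr
      (fun z hz => (h.isFirstReturnTime_of_subset_entryDomain hT1 isPreconnected_Icc huI
        hent hx hr hz).2.1)
      (fun hy => hB.2.2.1 r y (by simp [hfr]) (hTB hy))
      (fun hy => hB.2.2.1 r y' (by simp [hfr]) (hTB hy))
    have hadI : Icc a d ⊆ Icc 0 1 := (Icc_subset_Icc h1 h4).trans hyI
    obtain ⟨k1, k2⟩ := h7 1 fun j _ => by
      have e1 := h.iterate_mem j (hadI ⟨le_rfl, by linarith⟩)
      have e2 := h.iterate_mem j (hadI ⟨by linarith, le_rfl⟩)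
      rw [abs_le]
      constructor <;> linarith [e1.1, e1.2, e2.1, e2.2]
    have hκw : ∀ t, 0 < t → v - u ≤ Real.exp (2 * Real.log (1 + 1 / τ) + C * 1) * t →
        κ * (v - u) < t := by
      intro t ht hle
      rw [hκ, one_div, inv_mul_lt_iff₀ (by positivity)]
      have := mul_pos hE ht
      linarith
    refine ⟨T, m, s, hT'.mono ((min_le_left _ _).trans (min_le_left _ _)), r, a, d, h1, ?_, ?_, h4,
      h5 r le_rfl, h6⟩
    · linarith [hκw (u - a) (by linarith) k1]
    · linarith [hκw (d - v) (by linarith) k2]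
  refine ⟨?_, ?_, fun δ hδ => ?_⟩
  · obtain ⟨_, _, _, _, _, a, d, h1, h2, h3, h4, -⟩ := key 1 one_pos
    linarith
  · obtain ⟨_, _, _, _, _, a, d, h1, h2, h3, h4, -⟩ := key 1 one_pos
    linarith
  · obtain ⟨T, m, s, hT, q, a, d, h1, h2, h3, h4, h5, h6⟩ := key δ hδ
    exact ⟨T, m, s, hT, q, h5.mono (Icc_subset_Icc h2.le h3.le),
      h6.mono_left (Icc_subset_Ioo h2 h3)⟩

lemma false_of_lt (hP : EntersSmallCascades f c τ u v) (h : UnimodalA f c l) (hC0 : 0 ≤ C)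
    (hC : OneStepCrossBound f c C) (hτ : 0 < τ) (huv : u < v) (hI : Icc u v ⊆ Icc 0 1) :
    False := by
  obtain ⟨T, m, s, u', v', hT, huv', hsub, hP'⟩ := hP.exists_image h huv hI
  have hB := hT.1.nice (Nat.zero_le m)
  have hcB := hT.1.c_mem (Nat.zero_le m)
  obtain ⟨y, y', hyy, hT0⟩ := hB.1
  rw [hT0] at hB hcB hsub
  obtain ⟨κ, hκ⟩ : ∃ κ, κ = 1 / (2 * Real.exp (2 * Real.log (1 + 1 / τ) + C * 1)) := ⟨_, rfl⟩
  have hκ0 : 0 < κ := by rw [hκ]; positivity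
  have key : ∀ n : ℕ, ∃ a b, (1 + n * (2 * κ)) * (v' - u') ≤ b - a ∧ y < a ∧ a < b ∧ b < y' ∧
      EntersSmallCascades f c τ a b := by
    intro n
    induction n with
    | zero =>
      exact ⟨u', v', by simp, (hsub ⟨le_rfl, huv'.le⟩).1, huv', (hsub ⟨huv'.le, le_rfl⟩).2, hP'⟩
    | succ n ih =>
      obtain ⟨a, b, h1, h2, h3, h4, h5⟩ := ih
      obtain ⟨k1, k2, k3⟩ := h5.extend h hC0 hC hτ h3 hB hcB h2 h4 hκ
      have hpos : 0 < κ * (b - a) := mul_pos hκ0 (by linarith)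
      refine ⟨_, _, ?_, k1, by linarith, k2, k3⟩
      have hle : v' - u' ≤ b - a := by
        have : 0 ≤ n * (2 * κ) * (v' - u') :=
          mul_nonneg (by positivity) (by linarith)
        linarith
      have := mul_le_mul_of_nonneg_left hle hκ0.le
      push_cast
      linarith
  obtain ⟨n, hn⟩ := exists_nat_gt ((y' - y) / (2 * κ * (v' - u')))
  have hpos : 0 < 2 * κ * (v' - u') := mul_pos (by linarith) (by linarith)
  rw [div_lt_iff₀ hpos] at hn
  obtain ⟨a, b, h1, h2, h3, h4, -⟩ := key n
  linarith

end EntersSmallCascades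

/-- Intervals mapped injectively by an iterate into a small cascade are short. -/
lemma exists_forall_sub_lt (h : UnimodalA f c l) (hC0 : 0 ≤ C) (hC : OneStepCrossBound f c C)
    (hτ : 0 < τ) {ε : ℝ} (hε : 0 < ε) : ∃ δ > 0, ∀ T m s, IsSmallCascade f c τ δ T m s →
      ∀ u v q, u ≤ v → Icc u v ⊆ Icc 0 1 → InjOn f^[q] (Icc u v) →
        MapsTo f^[q] (Ioo u v) (T 0) → v - u < ε := by
  by_contra! hcon
  choose T m s hT u v q huv hI hinj hmaps hlong using
    fun n : ℕ => hcon (1 / (n + 1)) Nat.one_div_pos_of_nat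
  have hmem : ∀ n, (u n, v n) ∈ Icc (0:ℝ) 1 ×ˢ Icc (0:ℝ) 1 := fun n =>
    ⟨hI n ⟨le_rfl, huv n⟩, hI n ⟨huv n, le_rfl⟩⟩
  obtain ⟨⟨u₀, v₀⟩, hmem₀, φ, hφ, hlim⟩ :=
    (isCompact_Icc.prod isCompact_Icc).tendsto_subseq hmem
  have hu : Tendsto (fun n => u (φ n)) atTop (𝓝 u₀) := (continuous_fst.tendsto _).comp hlim
  have hv : Tendsto (fun n => v (φ n)) atTop (𝓝 v₀) := (continuous_snd.tendsto _).comp hlim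
  have huv₀ : ε ≤ v₀ - u₀ := ge_of_tendsto' (hv.sub hu) fun n => hlong (φ n)
  have hP : EntersSmallCascades f c τ (u₀ + ε / 3) (v₀ - ε / 3) := by
    intro δ hδ
    obtain ⟨n, hn1, hn2, hn3⟩ := ((hu.eventually_lt_const (by linarith : u₀ < u₀ + ε / 3)).and
      ((hv.eventually_const_lt (by linarith : v₀ - ε / 3 < v₀)).and
      (hφ.tendsto_atTop.eventually
        (tendsto_one_div_add_atTop_nhds_zero_nat.eventually_lt_const hδ)))).exists
    exact ⟨_, _, _, (hT (φ n)).mono hn3.le, q (φ n),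
      (hinj (φ n)).mono (Icc_subset_Icc hn1.le hn2.le),
      (hmaps (φ n)).mono_left (Icc_subset_Ioo hn1 hn2)⟩
  exact hP.false_of_lt h hC0 hC hτ (by linarith) (Icc_subset_Icc (by linarith [hmem₀.1.1])
    (by linarith [hmem₀.2.2]))

end Contraction

section ReturnDomains

variable {f : ℝ → ℝ} {c l C τ : ℝ}

lemma UnimodalA.isOpen_entryDomain_inter (h : UnimodalA f c l) {T : Set ℝ}
    (hT : IsNiceInterval f T) : IsOpen (entryDomain f T ∩ T) := by
  have : entryDomain f T ∩ T = ⋃ k ∈ {k : ℕ | 1 ≤ k}, T ∩ f^[k] ⁻¹' T := by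
    ext x
    simp only [entryDomain, mem_inter_iff, mem_ofPred_eq, mem_iUnion, mem_preimage, exists_prop]
    exact ⟨fun ⟨⟨k, h1, h2⟩, h3⟩ => ⟨k, h1, h3, h2⟩, fun ⟨k, h1, h3, h2⟩ => ⟨⟨k, h1, h2⟩, h3⟩⟩
  rw [this]
  exact isOpen_biUnion fun k _ =>
    ((h.continuousOn_iterate k).mono hT.2.1).isOpen_inter_preimage hT.isOpen hT.isOpen

lemma exists_eq_Ioo_of_isPreconnected {J : Set ℝ} (ho : IsOpen J) (hJ : IsPreconnected J)
    {x y y' : ℝ} (hx : x ∈ J) (hb : J ⊆ Ioo y y') :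
    ∃ α β, y ≤ α ∧ α < x ∧ x < β ∧ β ≤ y' ∧ J = Ioo α β := by
  have hbb : BddBelow J := ⟨y, fun z hz => (hb hz).1.le⟩
  have hba : BddAbove J := ⟨y', fun z hz => (hb hz).2.le⟩
  have hsub : J ⊆ Ioo (sInf J) (sSup J) := by
    have : J ⊆ Icc (sInf J) (sSup J) := fun z hz => ⟨csInf_le hbb hz, le_csSup hba hz⟩
    have := interior_mono this
    rwa [ho.interior_eq, interior_Icc] at this
  exact ⟨sInf J, sSup J, le_csInf ⟨x, hx⟩ fun z hz => (hb hz).1.le, (hsub hx).1, (hsub hx).2,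
    csSup_le ⟨x, hx⟩ fun z hz => (hb hz).2.le,
    hsub.antisymm (IsConnected.Ioo_csInf_csSup_subset ⟨⟨x, hx⟩, hJ⟩ hbb hba)⟩

lemma IsMaximalCentralCascade.mul_le_of_isFirstReturnTime {T : ℕ → Set ℝ} {m s : ℕ}
    (hT : IsMaximalCentralCascade f c T m s) (h : UnimodalA f c l) {i : ℕ} (him : i < m) {x : ℝ}
    (hx : x ∈ T i) (hx' : x ∉ T (i + 1)) {r : ℕ} (hr : IsFirstReturnTime f (T i) x r) :
    i * s ≤ r := by
  by_contra! hlt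
  have hs : 1 ≤ s := hT.2.1
  have ha : r / s < i := Nat.div_lt_of_lt_mul (by rwa [mul_comm])
  have hdiv : r = r % s + r / s * s := by
    rw [mul_comm]; exact (Nat.mod_add_div r s).symm
  generalize r / s = t at ha hdiv
  obtain ⟨e, he⟩ : ∃ e, i = e + 1 + t := ⟨i - t - 1, by omega⟩
  have hrT := hr.2.1
  rw [hdiv, iterate_add_apply] at hrT
  rcases Nat.eq_zero_or_pos (r % s) with hu | hu
  · rw [hu] at hrT
    have ha1 : 1 ≤ t := by
      rcases Nat.eq_zero_or_pos (t) with h' | h'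
      · rw [h', hu] at hdiv
        have := hr.1
        omega
      · exact h'
    have := (hT.iterate_mem_diff h (a := e + 1) (t) (by omega) x (he ▸ hx)
      (he ▸ hx')).2
    exact this (hT.subset_of_le (by omega) him.le hrT)
  · have hmem := hT.iterate_mem h (a := e + 1) (t) (by omega) x (he ▸ hx)
    exact (hT.isFirstReturnTime h (by omega) hmem).2.2 _ hu (Nat.mod_lt r hs)
      (hT.subset_of_le (by omega) him.le hrT)

lemma UnimodalA.abs_iterate_sub_lt (h : UnimodalA f c l) {ε : ℝ} {T : Set ℝ}
    (hT : ∀ u v q, u ≤ v → Icc u v ⊆ Icc 0 1 → InjOn f^[q] (Icc u v) →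
      MapsTo f^[q] (Ioo u v) T → v - u < ε) {a d : ℝ} (had : a ≤ d) (hI : Icc a d ⊆ Icc 0 1)
    {j r : ℕ} (hjr : j ≤ r) (hinj : InjOn f^[r] (Icc a d)) (hmaps : MapsTo f^[r] (Ioo a d) T) :
    |f^[j] d - f^[j] a| < ε := by
  have hj : InjOn f^[j] (Icc a d) := injOn_iterate_of_le hjr hinj
  have hcont := (h.continuousOn_iterate j).mono hI
  have hma : a ∈ Icc a d := ⟨le_rfl, had⟩
  have hmd : d ∈ Icc a d := ⟨had, le_rfl⟩
  have key : ∀ p q, p ≤ q → (p = f^[j] a ∧ q = f^[j] d ∨ p = f^[j] d ∧ q = f^[j] a) →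
      Icc p q ⊆ f^[j] '' Icc a d → q - p < ε := by
    intro p q hpq hends hsub
    refine hT p q (r - j) hpq (hsub.trans ?_) ?_ ?_
    · rintro _ ⟨z, hz, rfl⟩
      exact h.iterate_mem j (hI hz)
    · intro w hw w' hw' hww
      obtain ⟨z, hz, rfl⟩ := hsub hw
      obtain ⟨z', hz', rfl⟩ := hsub hw'
      rw [iterate_sub_iterate hjr, iterate_sub_iterate hjr] at hww
      rw [hinj hz hz' hww]
    · intro w hw
      obtain ⟨z, hz, rfl⟩ := hsub (Ioo_subset_Icc_self hw)
      rw [iterate_sub_iterate hjr]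
      have hza : a ≠ z := by
        rintro rfl
        rcases hends with ⟨h1, -⟩ | ⟨-, h1⟩
        · exact hw.1.ne h1
        · exact hw.2.ne' h1
      have hzd : z ≠ d := by
        rintro rfl
        rcases hends with ⟨-, h1⟩ | ⟨h1, -⟩
        · exact hw.2.ne' h1
        · exact hw.1.ne h1
      exact hmaps ⟨lt_of_le_of_ne hz.1 hza, lt_of_le_of_ne hz.2 hzd⟩
  rcases h.strictMonoOn_or_strictAntiOn had hI hj with hm | hm
  · have hle := hm.monotoneOn hma hmd had
    rw [abs_of_nonneg (sub_nonneg.2 hle)]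
    exact key _ _ hle (Or.inl ⟨rfl, rfl⟩) (intermediate_value_Icc had hcont)
  · have hle := hm.antitoneOn hma hmd had
    rw [abs_sub_comm, abs_of_nonneg (sub_nonneg.2 hle)]
    exact key _ _ hle (Or.inr ⟨rfl, rfl⟩) (intermediate_value_Icc' had hcont)

lemma sub_le_mul_of_forall_Ioo {E α β x y y' : ℝ} (hαx : α < x) (hxβ : x < β)
    (hJ : ∀ b b', α < b → b < x → x < b' → b' < β →
      b' - b ≤ E * (b - y) ∧ b' - b ≤ E * (y' - b')) :
    β - α ≤ E * (α - y) ∧ β - α ≤ E * (y' - β) := by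
  have hα : Tendsto (fun b : ℝ => b) (𝓝[>] α) (𝓝 α) := tendsto_id.mono_left nhdsWithin_le_nhds
  have hβ : Tendsto (fun b : ℝ => b) (𝓝[<] β) (𝓝 β) := tendsto_id.mono_left nhdsWithin_le_nhds
  have hev : ∀ᶠ b in 𝓝[>] α, b ∈ Ioo α x := Ioo_mem_nhdsGT hαx
  have hev' : ∀ᶠ b in 𝓝[<] β, b ∈ Ioo x β := Ioo_mem_nhdsLT hxβ
  constructor
  · refine le_of_tendsto_of_tendsto (tendsto_const_nhds.sub hα) ((hα.sub_const y).const_mul E) ?_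
    filter_upwards [hev] with b hb
    refine le_of_tendsto (hβ.sub_const b) ?_
    filter_upwards [hev'] with b' hb'
    exact (hJ b b' hb.1 hb.2 hb'.1 hb'.2).1
  · refine le_of_tendsto_of_tendsto (hβ.sub_const α) ((hβ.const_sub y').const_mul E) ?_
    filter_upwards [hev'] with b' hb'
    refine le_of_tendsto (tendsto_const_nhds.sub hα) ?_
    filter_upwards [hev] with b hb
    exact (hJ b b' hb.1 hb.2 hb'.1 hb'.2).2

lemma IsMaximalCentralCascade.isNonCentralTauNice {T : ℕ → Set ℝ} {m s : ℕ}
    (hT : IsMaximalCentralCascade f c T m s) (h : UnimodalA f c l) (hC0 : 0 ≤ C)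
    (hC : OneStepCrossBound f c C) (hτ : 0 < τ) (hw : WellInside τ (T 1) (T 0)) {ε : ℝ}
    (hε : ∀ u v q, u ≤ v → Icc u v ⊆ Icc 0 1 → InjOn f^[q] (Icc u v) →
      MapsTo f^[q] (Ioo u v) (T 0) → v - u < ε) {i : ℕ} (hi : 1 ≤ i) (him : i < m) :
    IsNonCentralTauNice f c (1 / Real.exp (2 * Real.log (1 + 1 / τ) + C * ε)) (T i) := by
  intro x hx hcx
  have hnice := hT.nice him.le
  obtain ⟨y, y', hyy, hTi⟩ := hnice.1
  have hxi : x ∉ T (i + 1) := by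
    intro hxi
    rw [hT.2.2.2.1 i him] at hxi
    apply hcx
    rw [returnDomain, ← connectedComponentIn_eq hxi]
    have := hT.c_mem him
    rwa [hT.2.2.2.1 i him] at this
  have hsub : returnDomain f (T i) x ⊆ entryDomain f (T i) ∩ T i := connectedComponentIn_subset _ _
  have hconn : IsPreconnected (returnDomain f (T i) x) := isPreconnected_connectedComponentIn
  have hxJ : x ∈ returnDomain f (T i) x := mem_connectedComponentIn hx
  obtain ⟨r, hr⟩ := exists_isFirstReturnTime hx.1
  have hrJ : ∀ z ∈ returnDomain f (T i) x, IsFirstReturnTime f (T i) z r := fun z hz =>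
    h.isFirstReturnTime_of_subset_entryDomain hnice hconn
      (fun w hw => hT.subset_Icc him.le (hsub hw).2) (fun w hw => (hsub hw).1) hxJ hr hz
  obtain ⟨α, β, hyα, hαx, hxβ, hβy, hJ⟩ := exists_eq_Ioo_of_isPreconnected
    (h.isOpen_entryDomain_inter hnice).connectedComponentIn hconn hxJ
    (fun w hw => show w ∈ Ioo y y' from hTi ▸ (hsub hw).2)
  change returnDomain f (T i) x = Ioo α β at hJ
  have hrs := hT.mul_le_of_isFirstReturnTime h him hx.2 hxi hr
  have hfr : ∀ w ∈ ({y, y'} : Set ℝ), f^[r] w ∉ T 0 := fun w hw =>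
    hT.iterate_frontier_notMem h i him.le w (by rwa [hTi, frontier_Ioo hyy]) r hrs
  have hyI : Icc y y' ⊆ Icc 0 1 := by
    have := hT.closure_subset_Icc him.le
    rwa [hTi, closure_Ioo hyy.ne] at this
  have hE : 0 < Real.exp (2 * Real.log (1 + 1 / τ) + C * ε) := Real.exp_pos _
  obtain ⟨k1, k2⟩ := sub_le_mul_of_forall_Ioo (y := y) (y' := y') hαx hxβ
    fun b b' hb hbx hxb hb' => by
      obtain ⟨a, d, h1, h2, h3, h4, h5, h6, h7⟩ := hT.exists_koebe_space h hC0 hC hτ hw hi him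
        (by linarith : y ≤ b) (hbx.trans hxb) (by linarith : b' ≤ y') hyI ⟨hbx.le, hxb.le⟩ hxi hr
        (fun z hz => (hrJ z (hJ ▸ ⟨by linarith [hz.1], by linarith [hz.2]⟩)).2.1)
        (hfr y (by simp)) (hfr y' (by simp))
      obtain ⟨e1, e2⟩ := h7 ε fun j hj =>
        (h.abs_iterate_sub_lt hε (by linarith) ((Icc_subset_Icc h1 h4).trans hyI) hj.le
          (h5 r le_rfl) h6).le
      exact ⟨e1.trans (mul_le_mul_of_nonneg_left (by linarith) hE.le),
        e2.trans (mul_le_mul_of_nonneg_left (by linarith) hE.le)⟩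
  refine ⟨α, β, y, y', hyα, hαx.trans hxβ, hβy, hJ, hTi, ?_, ?_⟩
  · rwa [one_div, inv_mul_le_iff₀ hE]
  · rwa [one_div, inv_mul_le_iff₀ hE]

lemma WellInside.mono {σ : ℝ} {J I : Set ℝ} (hw : WellInside τ J I) (hσ : σ ≤ τ) :
    WellInside σ J I := by
  obtain ⟨a, b, a', b', h1, h2, h3, h4, h5, h6, h7⟩ := hw
  have := mul_le_mul_of_nonneg_right hσ (sub_nonneg.2 h2.le)
  exact ⟨a, b, a', b', h1, h2, h3, h4, h5, this.trans h6, this.trans h7⟩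

end ReturnDomains

/-- Lemma 3.9: in a maximal central cascade `T⁰ ⊃ T¹ ⊃ ⋯ ⊃ Tᵐ` with `T¹` `τ`-well
inside `T⁰`, each `Tⁱ` for `1 ≤ i < m` is `τ'`-non-central-nice, where `τ'` depends
only on `τ` (and `ℓ`). -/
theorem cascade_non_central_nice (ℓ : ℝ) (hℓ : 1 < ℓ) :
    ∀ τ > 0, ∃ τ' > 0, ∀ f : ℝ → ℝ, ∀ c : ℝ,
      UnimodalAStar f c ℓ → c ∈ omegaLimitSet f c →
      ∃ δ > 0, ∀ (T : ℕ → Set ℝ) (m s : ℕ), IsMaximalCentralCascade f c T m s →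
        len (T 0) < δ → WellInside τ (T 1) (T 0) →
        ∀ i : ℕ, 1 ≤ i → i < m → IsNonCentralTauNice f c τ' (T i) := by
  intro τ hτ
  refine ⟨1 / Real.exp (2 * Real.log (1 + 1 / τ) + 1), by positivity, fun f c hf _ => ?_⟩
  obtain ⟨C, hC0, hC⟩ := hf.1.exists_crossLog_le
  have hC1 : 0 < C + 1 := by linarith
  obtain ⟨δ, hδ, hδ'⟩ := exists_forall_sub_lt hf.1 hC0 hC hτ (one_div_pos.2 hC1)
  refine ⟨δ, hδ, fun T m s hT hlen hw i hi him x hx hcx => ?_⟩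
  refine (hT.isNonCentralTauNice hf.1 hC0 hC hτ hw
    (hδ' T m s ⟨hT, by omega, hlen, hw⟩) hi him x hx hcx).mono ?_
  have hle : C * (1 / (C + 1)) ≤ 1 := by
    rw [mul_one_div, div_le_one hC1]
    linarith
  exact one_div_le_one_div_of_le (Real.exp_pos _) (Real.exp_le_exp.2 (by linarith))
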